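/- arXiv:2501.05315 — 4 statements merged into one kernel-verified Lean document; each statement's English description precedes it below -/
import Mathlib

section
/- Let n ≥ 1, let p_1, …, p_n be distinct points in ℝ³, let ζ_1, …, ζ_n ∈ ℝ ∖ {0}, and let V(x) = Σ_{i=1}^n ζ_i/‖x − p_i‖ on ℝ³ ∖ {p_1, …, p_n}. Assume that at every critical point x of V one has Σ_{i=1}^n ζ_i ∏_{ℓ≠i} ‖x − p_ℓ‖³ ≠ 0 (which holds for the generic position of p_1). Then the set of isolated critical points of V has cardinality at most 2^n · (3n − 2)³. -/
noncomputable section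

open Finset

abbrev E3 := EuclideanSpace ℝ (Fin 3)

/-- The electrostatic potential of `n` point charges of magnitudes `ζ i` at points `p i`. -/
def pot {n : ℕ} (p : Fin n → E3) (ζ : Fin n → ℝ) : E3 → ℝ :=
  fun x => ∑ i, ζ i / ‖x - p i‖

/-- The set of critical points (equilibria) of the potential. -/
def critSet {n : ℕ} (p : Fin n → E3) (ζ : Fin n → ℝ) : Set E3 :=
  {x | (∀ i, x ≠ p i) ∧ fderiv ℝ (pot p ζ) x = 0}

/-- The set of isolated critical points of the potential. -/
def isoCritSet {n : ℕ} (p : Fin n → E3) (ζ : Fin n → ℝ) : Set E3 :=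
  {x ∈ critSet p ζ | ∃ U ∈ nhds x, ∀ y ∈ U, y ∈ critSet p ζ → y = x}

section Helpers

/-! ### Counting exponents -/

/-- The exponents of the monomials of degree at most `D` in three variables. -/
def exponents (D : ℕ) : Finset (Fin 3 →₀ ℕ) :=
  (range (D + 1)).biUnion fun d => finsuppAntidiag univ d

lemma mem_exponents {D : ℕ} {a : Fin 3 →₀ ℕ} : a ∈ exponents D ↔ a.degree ≤ D := by
  simp [exponents, mem_finsuppAntidiag, Finsupp.degree_eq_sum]

lemma card_exponents (D : ℕ) : 6 * #(exponents D) = (D + 1) * (D + 2) * (D + 3) := by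
  have hsum : #(exponents D) = ∑ d ∈ range (D + 1), (d + 2).choose 2 := by
    rw [exponents, card_biUnion]
    · refine sum_congr rfl fun d _ => ?_
      rw [card_finsuppAntidiag_nat_eq_choose, card_univ, Fintype.card_fin,
        show 3 + d - 1 = d + 2 by omega, ← Nat.choose_symm_add]
    · intro i _ j _ hij
      rw [Function.onFun, disjoint_left]
      intro a ha hb
      rw [mem_finsuppAntidiag] at ha hb
      exact hij (ha.1.symm.trans hb.1)
  rw [hsum]
  clear hsum
  induction D with
  | zero => simp
  | succ D ih =>
    rw [sum_range_succ, mul_add, ih]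
    have h : (D + 1 + 2).choose 2 * 2 = (D + 3) * (D + 2) := by
      have h1 := Nat.add_one_mul_choose_eq (D + 2) 1
      rw [Nat.choose_one_right] at h1
      exact h1.symm
    linarith [congrArg (3 * ·) h]

lemma card_filter_even_powerset {n : ℕ} (hn : 1 ≤ n) :
    2 * #{s : Finset (Fin n) | Even #s} = 2 ^ n := by
  have h1 := sum_powerset_neg_one_pow_card (x := (univ : Finset (Fin n)))
  have hne : (univ : Finset (Fin n)) ≠ ∅ := by
    have : Nonempty (Fin n) := ⟨⟨0, hn⟩⟩
    exact univ_nonempty.ne_empty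
  rw [if_neg hne, powerset_univ, ← sum_filter_add_sum_filter_not univ (fun s => Even #s)] at h1
  have h2 : ∑ s ∈ {s : Finset (Fin n) | Even #s}, (-1 : ℤ) ^ #s
      = #{s : Finset (Fin n) | Even #s} := by
    rw [sum_congr rfl fun s hs => (mem_filter.1 hs).2.neg_one_pow]
    simp
  have h3 : ∑ s ∈ {s : Finset (Fin n) | ¬ Even #s}, (-1 : ℤ) ^ #s
      = -#{s : Finset (Fin n) | ¬ Even #s} := by
    rw [sum_congr rfl fun s hs => (Nat.not_even_iff_odd.1 (mem_filter.1 hs).2).neg_one_pow]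
    simp
  have h4 := card_filter_add_card_filter_not (s := (univ : Finset (Finset (Fin n))))
    (fun s => Even #s)
  rw [card_univ, Fintype.card_finset, Fintype.card_fin] at h4
  rw [h2, h3] at h1
  omega

/-- A growth comparison: a bound on numbers of exponents valid in all degrees bounds the
ratio of the leading coefficients. -/
lemma le_mul_pow_three_of_card_exponents_le {M K d c : ℕ}
    (h : ∀ D, M * #(exponents D) ≤ K * #(exponents (c + d * D))) : M ≤ K * d ^ 3 := by
  have h' : ∀ D : ℕ, (M : ℝ) * ((1 + 1 * (D : ℝ)⁻¹) * (1 + 2 * (D : ℝ)⁻¹) * (1 + 3 * (D : ℝ)⁻¹))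
      ≤ K * ((d + (c + 1) * (D : ℝ)⁻¹) * (d + (c + 2) * (D : ℝ)⁻¹) * (d + (c + 3) * (D : ℝ)⁻¹))
      ∨ D = 0 := by
    intro D
    rcases Nat.eq_zero_or_pos D with h0 | h0
    · exact Or.inr h0
    left
    have h1 : M * ((D + 1) * (D + 2) * (D + 3))
        ≤ K * ((c + d * D + 1) * (c + d * D + 2) * (c + d * D + 3)) := by
      rw [← card_exponents, ← card_exponents]
      linarith [h D]
    have h2 : (M : ℝ) * ((D + 1) * (D + 2) * (D + 3))
        ≤ K * ((c + d * D + 1) * (c + d * D + 2) * (c + d * D + 3)) := by exact_mod_cast h1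
    have hD : (0 : ℝ) < D := by exact_mod_cast h0
    have e1 : (M : ℝ) * ((1 + 1 * (D : ℝ)⁻¹) * (1 + 2 * (D : ℝ)⁻¹) * (1 + 3 * (D : ℝ)⁻¹))
        = M * ((D + 1) * (D + 2) * (D + 3)) / D ^ 3 := by field_simp
    have e2 : K * ((d + (c + 1) * (D : ℝ)⁻¹) * (d + (c + 2) * (D : ℝ)⁻¹)
          * (d + (c + 3) * (D : ℝ)⁻¹))
        = K * ((c + d * D + 1) * (c + d * D + 2) * (c + d * D + 3)) / D ^ 3 := by
      field_simp
      ring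
    rw [e1, e2]
    gcongr
  have hi := tendsto_inv_atTop_nhds_zero_nat (𝕜 := ℝ)
  have hlim : ∀ u v : ℝ, Filter.Tendsto (fun D : ℕ => u + v * (D : ℝ)⁻¹) Filter.atTop (nhds u) := by
    intro u v
    simpa using (hi.const_mul v).const_add u
  have hle := le_of_tendsto_of_tendsto
    ((((hlim 1 1).mul (hlim 1 2)).mul (hlim 1 3)).const_mul (M : ℝ))
    ((((hlim d (c + 1)).mul (hlim d (c + 2))).mul (hlim d (c + 3))).const_mul (K : ℝ))
    (by
      filter_upwards [Filter.eventually_gt_atTop 0] with D hD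
      exact (h' D).resolve_right hD.ne')
  have h5 : (M : ℝ) ≤ K * (d : ℝ) ^ 3 := by linarith [hle]
  exact_mod_cast h5

/-! ### The filtered algebra generated by coordinates and even products of distances -/

/-- A monomial in the coordinates, the squared norm and the distances to the points `p i`. -/
def distMonomial {n : ℕ} (p : Fin n → E3) (a : Fin 3 →₀ ℕ) (c : ℕ) (β : Fin n → ℕ) : E3 → ℝ :=
  fun x => x 0 ^ a 0 * x 1 ^ a 1 * (‖x‖ ^ 2) ^ a 2 * x 2 ^ c * ∏ i, ‖x - p i‖ ^ β i

/-- The functions of weight at most `D` which are even in the distances. The coordinates and the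
squared norm have weight one, each distance has weight one half. -/
def weightLE {n : ℕ} (p : Fin n → E3) (D : ℕ) : Submodule ℝ (E3 → ℝ) :=
  Submodule.span ℝ {f | ∃ a c β, Even (∑ i, β i) ∧ 2 * (a.degree + c) + ∑ i, β i ≤ 2 * D ∧
    distMonomial p a c β = f}

variable {n : ℕ} {p : Fin n → E3}

lemma distMonomial_mem {D : ℕ} {a : Fin 3 →₀ ℕ} {c : ℕ} {β : Fin n → ℕ} (he : Even (∑ i, β i))
    (h : 2 * (a.degree + c) + ∑ i, β i ≤ 2 * D) : distMonomial p a c β ∈ weightLE p D :=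
  Submodule.subset_span ⟨a, c, β, he, h, rfl⟩

lemma weightLE_mono {D D' : ℕ} (h : D ≤ D') : weightLE p D ≤ weightLE p D' := by
  refine Submodule.span_mono ?_
  rintro _ ⟨a, c, β, he, hw, rfl⟩
  exact ⟨a, c, β, he, by omega, rfl⟩

lemma distMonomial_mul (a a' : Fin 3 →₀ ℕ) (c c' : ℕ) (β β' : Fin n → ℕ) :
    distMonomial p a c β * distMonomial p a' c' β' = distMonomial p (a + a') (c + c') (β + β') := by
  ext x
  simp only [distMonomial, Pi.mul_apply, Finsupp.add_apply, Pi.add_apply, pow_add,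
    prod_mul_distrib]
  ring

lemma mul_mem_weightLE {D D' : ℕ} {f g : E3 → ℝ} (hf : f ∈ weightLE p D)
    (hg : g ∈ weightLE p D') : f * g ∈ weightLE p (D + D') := by
  have h := Submodule.mul_mem_mul hf hg
  rw [weightLE, weightLE, Submodule.span_mul_span] at h
  refine Submodule.span_mono ?_ h
  rintro _ ⟨_, ⟨a, c, β, he, hw, rfl⟩, _, ⟨a', c', β', he', hw', rfl⟩, rfl⟩
  refine ⟨a + a', c + c', β + β', ?_, ?_, (distMonomial_mul ..).symm⟩
  · simpa [sum_add_distrib] using he.add he'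
  · simp only [Pi.add_apply, sum_add_distrib, map_add]
    omega

lemma one_mem_weightLE (D : ℕ) : (1 : E3 → ℝ) ∈ weightLE p D := by
  have h : distMonomial p 0 0 0 ∈ weightLE p D := distMonomial_mem (by simp) (by simp)
  convert h
  ext x
  simp [distMonomial]

lemma const_mem_weightLE (D : ℕ) (r : ℝ) : (fun _ => r : E3 → ℝ) ∈ weightLE p D := by
  convert (weightLE p D).smul_mem r (one_mem_weightLE D) using 1
  ext x
  simp

lemma pow_mem_weightLE {D : ℕ} {f : E3 → ℝ} (hf : f ∈ weightLE p D) (k : ℕ) :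
    f ^ k ∈ weightLE p (D * k) := by
  induction k with
  | zero => simpa using one_mem_weightLE _
  | succ k ih => rw [pow_succ, mul_add_one]; exact mul_mem_weightLE ih hf

lemma prod_mem_weightLE {ι : Type*} (s : Finset ι) (w : ι → ℕ) (f : ι → E3 → ℝ)
    (hf : ∀ i ∈ s, f i ∈ weightLE p (w i)) : ∏ i ∈ s, f i ∈ weightLE p (∑ i ∈ s, w i) := by
  classical
  induction s using Finset.induction_on with
  | empty => simpa using one_mem_weightLE _
  | insert i s hi ih =>
    rw [prod_insert hi, sum_insert hi]
    exact mul_mem_weightLE (hf i (mem_insert_self i s)) (ih fun j hj => hf j (mem_insert_of_mem hj))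

lemma coord_mem_weightLE (k : Fin 3) : (fun x : E3 => x k) ∈ weightLE p 1 := by
  fin_cases k
  · have h : distMonomial p (Finsupp.single 0 1) 0 0 ∈ weightLE p 1 :=
      distMonomial_mem (by simp) (by simp)
    convert h using 2
    simp [distMonomial]
  · have h : distMonomial p (Finsupp.single 1 1) 0 0 ∈ weightLE p 1 :=
      distMonomial_mem (by simp) (by simp)
    convert h using 2
    simp [distMonomial]
  · have h : distMonomial p 0 1 0 ∈ weightLE p 1 :=
      distMonomial_mem (by simp) (by simp)
    convert h using 2
    simp [distMonomial]

lemma norm_sq_eq_sum_three (x : E3) : ‖x‖ ^ 2 = x 0 ^ 2 + x 1 ^ 2 + x 2 ^ 2 := by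
  simp [EuclideanSpace.norm_sq_eq, Fin.sum_univ_three]

lemma norm_sub_sq_eq (x z : E3) :
    ‖x - z‖ ^ 2 = ‖x‖ ^ 2 - 2 * z 0 * x 0 - 2 * z 1 * x 1 - 2 * z 2 * x 2 + ‖z‖ ^ 2 := by
  simp only [norm_sq_eq_sum_three, PiLp.sub_apply]
  ring

lemma norm_sub_sq_mem_weightLE (z : E3) : (fun x : E3 => ‖x - z‖ ^ 2) ∈ weightLE p 1 := by
  have h : distMonomial p (Finsupp.single 2 1) 0 0 ∈ weightLE p 1 :=
    distMonomial_mem (by simp) (by simp)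
  have hc := fun k => coord_mem_weightLE (p := p) k
  have hs := (weightLE p 1).add_mem ((weightLE p 1).sub_mem ((weightLE p 1).sub_mem
    ((weightLE p 1).sub_mem h ((weightLE p 1).smul_mem (2 * z 0) (hc 0)))
    ((weightLE p 1).smul_mem (2 * z 1) (hc 1))) ((weightLE p 1).smul_mem (2 * z 2) (hc 2)))
    (const_mem_weightLE 1 (‖z‖ ^ 2))
  convert hs using 1
  ext x
  simp [distMonomial, norm_sub_sq_eq x z]

open Classical in
/-- The reduced monomials of weight at most `D`, which span `weightLE p D`. -/
def reducedMonomials {n : ℕ} (p : Fin n → E3) (D : ℕ) : Finset (E3 → ℝ) :=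
  (exponents D ×ˢ range 2 ×ˢ ({s | Even #s} : Finset (Finset (Fin n)))).image
    fun t => distMonomial p t.1 t.2.1 fun i => if i ∈ t.2.2 then 1 else 0

open Classical in
lemma card_reducedMonomials_le (hn : 1 ≤ n) (D : ℕ) :
    #(reducedMonomials p D) ≤ 2 ^ n * #(exponents D) := by
  refine card_image_le.trans ?_
  rw [card_product, card_product, card_range, card_filter_even_powerset hn, mul_comm]

lemma distMonomial_mem_span_of_le_one {D : ℕ} {β : Fin n → ℕ} (he : Even (∑ i, β i))
    (hβ : ∀ i, β i ≤ 1) (c : ℕ) : ∀ a : Fin 3 →₀ ℕ, a.degree + c ≤ D →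
      distMonomial p a c β ∈ Submodule.span ℝ (reducedMonomials p D : Set (E3 → ℝ)) := by
  classical
  induction c using Nat.strong_induction_on with
  | _ c ih =>
    intro a ha
    rcases Nat.lt_or_ge c 2 with hc | hc
    · refine Submodule.subset_span ?_
      have h01 : ∀ i, β i = if i ∈ ({i | β i = 1} : Finset (Fin n)) then 1 else 0 := by
        intro i
        have := hβ i
        simp only [mem_filter, mem_univ, true_and]
        split_ifs <;> omega
      rw [reducedMonomials, coe_image]
      refine ⟨(a, c, ({i | β i = 1} : Finset (Fin n))), ?_, ?_⟩
      · simp only [coe_product, Set.mem_prod, mem_coe, mem_exponents, mem_range, mem_filter,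
          mem_univ, true_and]
        refine ⟨by omega, hc, ?_⟩
        rwa [card_filter, ← sum_congr rfl fun i _ => (h01 i).trans (by simp)]
      · exact congrArg (distMonomial p a c) (funext fun i => (h01 i).symm)
    · obtain ⟨c, rfl⟩ := Nat.exists_eq_add_of_le' hc
      have key : distMonomial p a (c + 2) β
          = distMonomial p (a + Finsupp.single 2 1) c β - distMonomial p (a + Finsupp.single 0 2) c β
            - distMonomial p (a + Finsupp.single 1 2) c β := by
        ext x
        have hx := norm_sq_eq_sum_three x
        simp [distMonomial, pow_add]
        linear_combination (-(x 0 ^ a 0 * x 1 ^ a 1 * (‖x‖ ^ 2) ^ a 2 * x 2 ^ c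
          * ∏ i, ‖x - p i‖ ^ β i)) * hx
      rw [key]
      refine Submodule.sub_mem _ (Submodule.sub_mem _ ?_ ?_) ?_ <;>
      · refine ih c (by omega) _ ?_
        simp only [map_add, Finsupp.degree_single]
        omega

lemma distMonomial_mem_span {D : ℕ} (N : ℕ) : ∀ (a : Fin 3 →₀ ℕ) (c : ℕ) (β : Fin n → ℕ),
    ∑ i, β i = N → Even N → 2 * (a.degree + c) + N ≤ 2 * D →
      distMonomial p a c β ∈ Submodule.span ℝ (reducedMonomials p D : Set (E3 → ℝ)) := by
  classical
  induction N using Nat.strong_induction_on with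
  | _ N ih =>
    intro a c β hN he hw
    by_cases hβ : ∀ i, β i ≤ 1
    · exact distMonomial_mem_span_of_le_one (hN ▸ he) hβ c a (by omega)
    push Not at hβ
    obtain ⟨i, hi⟩ := hβ
    obtain ⟨γ, rfl⟩ : ∃ γ : Fin n → ℕ, β = γ + Pi.single i 2 := by
      refine ⟨β - Pi.single i 2, ?_⟩
      ext j
      rcases eq_or_ne j i with rfl | hj
      · simp; omega
      · simp [hj]
    have hsum : ∑ j, γ j + 2 = N := by simpa [sum_add_distrib] using hN
    have he' : Even (N - 2) := by
      obtain ⟨k, hk⟩ := he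
      exact ⟨k - 1, by omega⟩
    have key : distMonomial p a c (γ + Pi.single i 2)
        = distMonomial p (a + Finsupp.single 2 1) c γ
          - (2 * p i 0) • distMonomial p (a + Finsupp.single 0 1) c γ
          - (2 * p i 1) • distMonomial p (a + Finsupp.single 1 1) c γ
          - (2 * p i 2) • distMonomial p a (c + 1) γ + ‖p i‖ ^ 2 • distMonomial p a c γ := by
      ext x
      have hprod : ∏ j, ‖x - p j‖ ^ ((γ + Pi.single i 2 : Fin n → ℕ) j)
          = (∏ j, ‖x - p j‖ ^ γ j) * ‖x - p i‖ ^ 2 := by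
        simp only [Pi.add_apply, pow_add, prod_mul_distrib]
        congr 1
        rw [prod_eq_single i]
        · simp
        · intro j _ hj
          simp [hj]
        · simp
      simp only [distMonomial, Pi.add_apply, Pi.sub_apply, Pi.smul_apply, smul_eq_mul] at hprod ⊢
      rw [hprod, norm_sub_sq_eq]
      simp [pow_add]
      ring
    have hmem : ∀ (a' : Fin 3 →₀ ℕ) (c' : ℕ), a'.degree + c' ≤ a.degree + c + 1 →
        distMonomial p a' c' γ ∈ Submodule.span ℝ (reducedMonomials p D : Set (E3 → ℝ)) :=
      fun a' c' h => ih (N - 2) (by omega) a' c' γ (by omega) he' (by omega)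
    rw [key]
    refine Submodule.add_mem _ (Submodule.sub_mem _ (Submodule.sub_mem _ (Submodule.sub_mem _
      (hmem _ _ ?_) (Submodule.smul_mem _ _ (hmem _ _ ?_)))
      (Submodule.smul_mem _ _ (hmem _ _ ?_))) (Submodule.smul_mem _ _ (hmem _ _ ?_)))
      (Submodule.smul_mem _ _ (hmem _ _ ?_)) <;>
    (try simp only [map_add, Finsupp.degree_single]) <;> omega

lemma weightLE_le_span (D : ℕ) :
    weightLE p D ≤ Submodule.span ℝ (reducedMonomials p D : Set (E3 → ℝ)) := by
  refine Submodule.span_le.2 ?_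
  rintro _ ⟨a, c, β, he, hw, rfl⟩
  exact distMonomial_mem_span _ a c β rfl he hw

/-- A linearly independent family of functions of weight at most `D` has at most
`2 ^ n * #(exponents D)` members. -/
lemma card_le_of_linearIndependent {ι : Type*} [Fintype ι] (hn : 1 ≤ n) {D : ℕ} {f : ι → E3 → ℝ}
    (hf : ∀ i, f i ∈ weightLE p D) (hli : LinearIndependent ℝ f) :
    Fintype.card ι ≤ 2 ^ n * #(exponents D) := by
  have h1 : Fintype.card ι ≤ #(reducedMonomials p D) := by
    rw [← Fintype.card_coe]
    refine linearIndependent_le_span_aux' f hli (reducedMonomials p D : Set (E3 → ℝ)) ?_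
    rintro _ ⟨i, rfl⟩
    exact weightLE_le_span D (hf i)
  exact h1.trans (card_reducedMonomials_le hn D)

/-! ### Nondegenerate zeros of functions of bounded weight -/

lemma eval_smul_of_isHomogeneous {P : MvPolynomial (Fin 3) ℝ} {m : ℕ} (hP : P.IsHomogeneous m)
    (t : ℝ) (v : Fin 3 → ℝ) : MvPolynomial.eval (t • v) P = t ^ m * MvPolynomial.eval v P := by
  rw [MvPolynomial.eval_eq', MvPolynomial.eval_eq', mul_sum]
  refine sum_congr rfl fun a ha => ?_
  have hd : a.degree = m := by
    by_contra h
    exact (MvPolynomial.mem_support_iff.1 ha) (hP.coeff_eq_zero h)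
  simp only [Pi.smul_apply, smul_eq_mul, mul_pow, prod_mul_distrib, prod_pow_eq_pow_sum]
  rw [← Finsupp.degree_eq_sum, hd]
  ring

open Filter Topology in
lemma tendsto_eval_div_pow {P : MvPolynomial (Fin 3) ℝ} {m : ℕ}
    (hP : ∀ i < m, MvPolynomial.homogeneousComponent i P = 0) {y : ℝ → Fin 3 → ℝ} {v : Fin 3 → ℝ}
    (hy : Tendsto (fun t => t⁻¹ • y t) (𝓝[≠] 0) (𝓝 v)) :
    Tendsto (fun t => (t ^ m)⁻¹ * MvPolynomial.eval (y t) P) (𝓝[≠] 0)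
      (𝓝 (MvPolynomial.eval v (MvPolynomial.homogeneousComponent m P))) := by
  set Q := fun i => MvPolynomial.homogeneousComponent i P
  set N := P.totalDegree + 1 + m
  have hsum : ∑ i ∈ range N, Q i = P := by
    rw [sum_range_add, MvPolynomial.sum_homogeneousComponent]
    simp only [add_eq_left]
    exact sum_eq_zero fun i _ => MvPolynomial.homogeneousComponent_eq_zero _ _ (by omega)
  have hlim : Tendsto (fun t : ℝ => ∑ i ∈ range N, t ^ (i - m) *
      MvPolynomial.eval (t⁻¹ • y t) (Q i)) (𝓝[≠] 0)
      (𝓝 (∑ i ∈ range N, (0 : ℝ) ^ (i - m) * MvPolynomial.eval v (Q i))) := by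
    refine tendsto_finsetSum _ fun i _ => Tendsto.mul ?_ ?_
    · exact ((continuous_pow (i - m)).tendsto 0).mono_left nhdsWithin_le_nhds
    · exact ((MvPolynomial.continuous_eval (Q i)).tendsto v).comp hy
  have hval : ∑ i ∈ range N, (0 : ℝ) ^ (i - m) * MvPolynomial.eval v (Q i)
      = MvPolynomial.eval v (Q m) := by
    rw [sum_eq_single m]
    · simp
    · intro i _ hi
      rcases lt_or_gt_of_ne hi with h | h
      · simp [Q, hP i h]
      · rw [zero_pow (by omega), zero_mul]
    · intro h
      exact absurd (mem_range.2 (by omega)) h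
  rw [hval] at hlim
  refine hlim.congr' ?_
  filter_upwards [self_mem_nhdsWithin] with t ht
  have ht : t ≠ 0 := ht
  conv_rhs => rw [← hsum, map_sum, mul_sum]
  refine sum_congr rfl fun i _ => ?_
  rcases lt_or_ge i m with h | h
  · simp [Q, hP i h]
  · have hy' : y t = t • (t⁻¹ • y t) := by rw [smul_smul, mul_inv_cancel₀ ht, one_smul]
    conv_rhs => rw [hy', eval_smul_of_isHomogeneous
      (MvPolynomial.homogeneousComponent_isHomogeneous i P)]
    rw [← mul_assoc]
    congr 1
    obtain ⟨j, rfl⟩ := Nat.exists_eq_add_of_le h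
    rw [add_tsub_cancel_left, pow_add, inv_mul_cancel_left₀ (pow_ne_zero _ ht)]

open Filter Topology in
lemma eq_zero_of_sum_mul_eval_eq_zero {ι : Type*} [Fintype ι] [DecidableEq ι] {z : ι → E3}
    {b : ι → E3 → ℝ} {f : E3 → Fin 3 → ℝ} {A : ι → E3 →L[ℝ] (Fin 3 → ℝ)}
    (hb : ∀ j k, ContinuousAt (b j) (z k)) (hbz : ∀ j k, b j (z k) = if j = k then 1 else 0)
    (hf : ∀ k, HasFDerivAt f (A k) (z k)) (hfz : ∀ k, f (z k) = 0)
    (hA : ∀ k, Function.Surjective (A k)) {P : ι → MvPolynomial (Fin 3) ℝ}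
    (h : ∀ x, ∑ j, b j x * MvPolynomial.eval (f x) (P j) = 0) (k : ι) : P k = 0 := by
  have key : ∀ m k, MvPolynomial.homogeneousComponent m (P k) = 0 := by
    intro m
    induction m using Nat.strong_induction_on with
    | _ m ih =>
      intro k
      refine MvPolynomial.funext fun v => ?_
      obtain ⟨w, rfl⟩ := hA k v
      have hline : Tendsto (fun t : ℝ => t⁻¹ • f (z k + t • w)) (𝓝[≠] 0) (𝓝 (A k w)) := by
        have h1 := ((hf k).hasLineDerivAt w).tendsto_slope_zero
        simpa [hfz k] using h1
      have hbt : ∀ j, Tendsto (fun t : ℝ => b j (z k + t • w)) (𝓝[≠] 0) (𝓝 (b j (z k))) := by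
        intro j
        refine Tendsto.comp (hb j k) (Tendsto.mono_left ?_ nhdsWithin_le_nhds)
        exact Continuous.tendsto' (by fun_prop) _ _ (by simp)
      have hlim := tendsto_finsetSum univ fun j _ =>
        (hbt j).mul (tendsto_eval_div_pow (fun i hi => ih i hi j) hline)
      have hzero : ∀ t : ℝ, ∑ j, b j (z k + t • w) *
          ((t ^ m)⁻¹ * MvPolynomial.eval (f (z k + t • w)) (P j)) = 0 := by
        intro t
        simp_rw [mul_left_comm _ ((t ^ m)⁻¹)]
        rw [← mul_sum, h, mul_zero]
      simp_rw [hzero, hbz] at hlim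
      have := tendsto_nhds_unique hlim tendsto_const_nhds
      simpa using this
  rw [← MvPolynomial.sum_homogeneousComponent (P k)]
  exact sum_eq_zero fun i _ => key i k

/-- Bézout-type bound: three functions of weight at most `d` have at most `2 ^ n * d ^ 3`
common nondegenerate zeros. -/
lemma card_nondegenerate_zeros_le (hn : 1 ≤ n) {d : ℕ} {f : Fin 3 → E3 → ℝ}
    (hf : ∀ k, f k ∈ weightLE p d) (s : Finset E3) (hs : ∀ z ∈ s, ∀ k, f k z = 0)
    (hnd : ∀ z ∈ s, ∃ A : E3 →L[ℝ] (Fin 3 → ℝ),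
      HasFDerivAt (fun x k => f k x) A z ∧ Function.Surjective A) :
    #s ≤ 2 ^ n * d ^ 3 := by
  classical
  choose! A hA hsurj using hnd
  let b : s → E3 → ℝ := fun z => ∏ y ∈ s.erase z, fun x => (‖(z : E3) - y‖ ^ 2)⁻¹ * ‖x - y‖ ^ 2
  have hbw : ∀ z, b z ∈ weightLE p #s := by
    intro z
    have h1 := prod_mem_weightLE (p := p) (s.erase (z : E3)) (fun _ => 1)
      (fun y x => (‖(z : E3) - y‖ ^ 2)⁻¹ * ‖x - y‖ ^ 2)
      fun y _ => (weightLE p 1).smul_mem _ (norm_sub_sq_mem_weightLE y)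
    refine weightLE_mono ?_ h1
    simp
  have hbc : ∀ z, Continuous (b z) := by
    intro z
    have : b z = fun x => ∏ y ∈ s.erase (z : E3), (‖(z : E3) - y‖ ^ 2)⁻¹ * ‖x - y‖ ^ 2 := by
      ext x
      simp [b]
    rw [this]
    fun_prop
  have hbz : ∀ z y : s, b z y = if z = y then 1 else 0 := by
    intro z y
    split_ifs with h
    · subst h
      simp only [b, prod_apply]
      refine prod_eq_one fun x hx => inv_mul_cancel₀ ?_
      exact pow_ne_zero _ (norm_ne_zero_iff.2 (sub_ne_zero.2 (ne_of_mem_erase hx).symm))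
    · simp only [b, prod_apply]
      refine prod_eq_zero (mem_erase.2 ⟨fun h' => h (Subtype.ext h'.symm), y.2⟩) ?_
      simp
  refine le_mul_pow_three_of_card_exponents_le (c := #s) fun D => ?_
  have hcard : Fintype.card (s × exponents D) = #s * #(exponents D) := by
    simp
  rw [← hcard]
  refine card_le_of_linearIndependent (p := p) hn
    (f := fun i => b i.1 * ∏ k, f k ^ (i.2 : Fin 3 →₀ ℕ) k) ?_ ?_
  · rintro ⟨z, a, ha⟩
    refine weightLE_mono ?_ (mul_mem_weightLE (hbw z)
      (prod_mem_weightLE univ _ _ fun k _ => pow_mem_weightLE (hf k) (a k)))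
    rw [← mul_sum, ← Finsupp.degree_eq_sum]
    gcongr
    exact mem_exponents.1 ha
  · rw [Fintype.linearIndependent_iff]
    rintro g hg ⟨z, a⟩
    let P : s → MvPolynomial (Fin 3) ℝ := fun z =>
      ∑ a : exponents D, MvPolynomial.monomial (a : Fin 3 →₀ ℕ) (g (z, a))
    have hP : ∀ z, P z = 0 := by
      refine eq_zero_of_sum_mul_eval_eq_zero (z := fun z : s => (z : E3)) (b := b)
        (f := fun x k => f k x) (fun j k => (hbc j).continuousAt) hbz (fun z => hA z z.2)
        (fun z => funext fun k => hs z z.2 k) (fun z => hsurj z z.2) fun x => ?_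
      have hx := congrFun hg x
      refine Eq.trans ?_ hx
      simp only [P, map_sum, MvPolynomial.eval_monomial, mul_sum, Fintype.sum_prod_type,
        Finset.sum_apply, Pi.smul_apply, Pi.mul_apply, prod_apply, Pi.pow_apply, smul_eq_mul]
      refine sum_congr rfl fun z _ => sum_congr rfl fun a _ => ?_
      rw [Finsupp.prod_fintype _ _ fun i => pow_zero _]
      ring
    have hcoeff := congrArg (MvPolynomial.coeff (a : Fin 3 →₀ ℕ)) (hP z)
    simpa [P, MvPolynomial.coeff_sum, MvPolynomial.coeff_monomial, Subtype.ext_iff.symm] using hcoeff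

/-! ### Functions whose partial derivatives have bounded weight -/

lemma hasFDerivAt_norm_sub {x q : E3} (hx : x ≠ q) :
    HasFDerivAt (fun y : E3 => ‖y - q‖) (‖x - q‖⁻¹ • innerSL ℝ (x - q)) x := by
  have hpos : 0 < ‖x - q‖ := norm_pos_iff.2 (sub_ne_zero.2 hx)
  have h1 := (((hasFDerivAt_id x).sub_const q).norm_sq).sqrt (pow_pos hpos 2).ne'
  simp only [id_eq, Real.sqrt_sq (norm_nonneg _)] at h1
  refine h1.congr_fderiv ?_
  ext v
  simp
  field_simp

lemma hasFDerivAt_norm_sub_pow {x q : E3} (hx : x ≠ q) {b : ℕ} (hb : b ≠ 1) :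
    HasFDerivAt (fun y : E3 => ‖y - q‖ ^ b)
      ((b * ‖x - q‖ ^ (b - 2)) • innerSL ℝ (x - q)) x := by
  have hpos : ‖x - q‖ ≠ 0 := norm_ne_zero_iff.2 (sub_ne_zero.2 hx)
  refine ((hasFDerivAt_norm_sub hx).pow b).congr_fderiv ?_
  rw [smul_smul]
  congr 1
  rcases Nat.lt_or_ge b 2 with h | h
  · obtain rfl : b = 0 := by omega
    simp
  · obtain ⟨c, rfl⟩ := Nat.exists_eq_add_of_le' h
    rw [show c + 2 - 1 = c + 1 by omega, show c + 2 - 2 = c by omega]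
    simp
    field_simp
    ring

/-- `g` is differentiable away from the points `p i`, and there its partial derivatives are
functions of weight at most `D`. -/
def HasGradWeightLE {n : ℕ} (p : Fin n → E3) (D : ℕ) (g : E3 → ℝ) : Prop :=
  ∃ h : Fin 3 → E3 → ℝ, (∀ k, h k ∈ weightLE p D) ∧ ∀ x, (∀ i, x ≠ p i) →
    HasFDerivAt g (∑ k, h k x • (EuclideanSpace.proj k : E3 →L[ℝ] ℝ)) x

lemma HasGradWeightLE.add {D : ℕ} {f g : E3 → ℝ} (hf : HasGradWeightLE p D f)
    (hg : HasGradWeightLE p D g) : HasGradWeightLE p D (f + g) := by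
  obtain ⟨u, hu, hu'⟩ := hf
  obtain ⟨v, hv, hv'⟩ := hg
  refine ⟨u + v, fun k => (weightLE p D).add_mem (hu k) (hv k), fun x hx => ?_⟩
  refine ((hu' x hx).add (hv' x hx)).congr_fderiv ?_
  simp [add_smul, sum_add_distrib]

lemma HasGradWeightLE.const_smul {D : ℕ} {f : E3 → ℝ} (hf : HasGradWeightLE p D f) (r : ℝ) :
    HasGradWeightLE p D (r • f) := by
  obtain ⟨u, hu, hu'⟩ := hf
  refine ⟨r • u, fun k => (weightLE p D).smul_mem r (hu k), fun x hx => ?_⟩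
  refine ((hu' x hx).const_smul r).congr_fderiv ?_
  simp [smul_sum, smul_smul]

lemma HasGradWeightLE.sum {ι : Type*} {D : ℕ} (s : Finset ι) {f : ι → E3 → ℝ}
    (hf : ∀ i ∈ s, HasGradWeightLE p D (f i)) : HasGradWeightLE p D (∑ i ∈ s, f i) := by
  classical
  induction s using Finset.induction_on with
  | empty => exact ⟨0, fun k => (weightLE p D).zero_mem, fun x _ =>
      (hasFDerivAt_const (0 : ℝ) x).congr_fderiv (by simp)⟩
  | insert i s hi ih =>
    rw [sum_insert hi]
    exact (hf i (mem_insert_self i s)).add (ih fun j hj => hf j (mem_insert_of_mem hj))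

lemma hasGradWeightLE_prod_norm_sub_pow {D : ℕ} {β : Fin n → ℕ} (he : Even (∑ i, β i))
    (hD : ∑ i, β i ≤ 2 * D) (hβ : ∀ i, β i ≠ 1) :
    HasGradWeightLE p D fun x => ∏ i, ‖x - p i‖ ^ β i := by
  refine ⟨fun k => ∑ i, (β i : ℝ) • (distMonomial p 0 0 (Function.update β i (β i - 2)) *
    fun x : E3 => x k - p i k), fun k => ?_, fun x hx => ?_⟩
  · refine Submodule.sum_mem _ fun i _ => ?_
    rcases Nat.eq_zero_or_pos (β i) with h0 | h0
    · simp [h0]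
    have hi2 : 2 ≤ β i := by have := hβ i; omega
    have hsum : ∑ j, Function.update β i (β i - 2) j + 2 = ∑ j, β j := by
      rw [sum_update_of_mem (mem_univ i), ← add_sum_erase univ β (mem_univ i), sdiff_singleton_eq_erase]
      omega
    refine Submodule.smul_mem _ _ ?_
    have hm : distMonomial p 0 0 (Function.update β i (β i - 2)) ∈ weightLE p (D - 1) := by
      refine distMonomial_mem ?_ ?_
      · obtain ⟨c, hc⟩ := he
        exact ⟨c - 1, by omega⟩
      · simp only [map_zero]
        omega
    have := mul_mem_weightLE hm
      ((weightLE p 1).sub_mem (coord_mem_weightLE k) (const_mem_weightLE 1 (p i k)))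
    rwa [show D - 1 + 1 = D by omega] at this
  · refine (HasFDerivAt.finsetProd (u := univ) fun i _ =>
      hasFDerivAt_norm_sub_pow (hx i) (hβ i)).congr_fderiv ?_
    ext v
    simp only [_root_.sum_apply, smul_apply, smul_eq_mul,
      PiLp.proj_apply, Finset.sum_apply, Pi.smul_apply, Pi.mul_apply, sum_mul]
    symm
    rw [sum_comm]
    refine sum_congr rfl fun i _ => ?_
    have hprod : distMonomial p 0 0 (Function.update β i (β i - 2)) x
        = (∏ j ∈ univ.erase i, ‖x - p j‖ ^ β j) * ‖x - p i‖ ^ (β i - 2) := by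
      simp only [distMonomial]
      rw [← mul_prod_erase univ _ (mem_univ i), Function.update_self,
        prod_congr rfl fun j hj => by rw [Function.update_of_ne (ne_of_mem_erase hj)]]
      simp [mul_comm]
    rw [hprod]
    simp only [innerSL_apply_apply, PiLp.inner_apply, mul_sum, PiLp.sub_apply]
    refine sum_congr rfl fun k _ => ?_
    simp
    ring

lemma differentiableAt_of_mem_weightLE {D : ℕ} {f : E3 → ℝ} (hf : f ∈ weightLE p D) {x : E3}
    (hx : ∀ i, x ≠ p i) : DifferentiableAt ℝ f x := by
  induction hf using Submodule.span_induction with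
  | mem f hf =>
    obtain ⟨a, c, β, -, -, rfl⟩ := hf
    have h1 : ∀ i, DifferentiableAt ℝ (fun y : E3 => ‖y - p i‖) x := fun i =>
      (hasFDerivAt_norm_sub (hx i)).differentiableAt
    have h2 : ∀ k, DifferentiableAt ℝ (fun y : E3 => y k) x := fun k =>
      (EuclideanSpace.proj k : E3 →L[ℝ] ℝ).differentiableAt
    have h3 : DifferentiableAt ℝ (fun y : E3 => ‖y‖ ^ 2) x :=
      (hasFDerivAt_id x).norm_sq.differentiableAt
    have h4 : DifferentiableAt ℝ (fun y : E3 => ∏ i, ‖y - p i‖ ^ β i) x :=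
      (HasFDerivAt.finsetProd fun i _ => ((h1 i).pow (β i)).hasFDerivAt).differentiableAt
    exact (((((h2 0).pow _).mul ((h2 1).pow _)).mul (h3.pow _)).mul ((h2 2).pow _)).mul h4
  | zero => exact differentiableAt_const _
  | add f g _ _ hf hg => exact hf.add hg
  | smul r f _ hf => exact hf.const_smul r

/-! ### The energy of the field -/

/-- The gradient of the potential, up to sign and with denominators cleared. -/
def clearedField {n : ℕ} (p : Fin n → E3) (ζ : Fin n → ℝ) (x : E3) : E3 :=
  ∑ i, (ζ i * ∏ l ∈ univ.erase i, ‖x - p l‖ ^ 3) • (x - p i)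

lemma continuous_clearedField (ζ : Fin n → ℝ) : Continuous (clearedField p ζ) := by
  unfold clearedField
  fun_prop

lemma prod_erase_norm_sub_pow (x : E3) (i : Fin n) :
    ∏ l ∈ univ.erase i, ‖x - p l‖ ^ 3 = ∏ l, ‖x - p l‖ ^ (if l = i then 0 else 3) := by
  rw [← mul_prod_erase univ (fun l => ‖x - p l‖ ^ (if l = i then 0 else 3)) (mem_univ i)]
  simp only [if_true, pow_zero, one_mul]
  exact prod_congr rfl fun l hl => by rw [if_neg (ne_of_mem_erase hl)]

lemma prod_norm_sub_pow_mul_sq (x : E3) (β : Fin n → ℕ) (i : Fin n) :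
    (∏ l, ‖x - p l‖ ^ β l) * ‖x - p i‖ ^ 2 = ∏ l, ‖x - p l‖ ^ (β + Pi.single i 2 : Fin n → ℕ) l := by
  simp only [Pi.add_apply, pow_add, prod_mul_distrib]
  congr 1
  rw [prod_eq_single i (fun l _ hl => by simp [hl]) (by simp)]
  simp

lemma sum_ite_eq_zero_three (i : Fin n) : ∑ l, (if l = i then 0 else 3) = 3 * (n - 1) := by
  rw [← add_sum_erase univ _ (mem_univ i), sum_congr rfl fun l hl => if_neg (ne_of_mem_erase hl)]
  simp [mul_comm]

lemma hasGradWeightLE_norm_clearedField_sq (hn : 1 ≤ n) (ζ : Fin n → ℝ) :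
    HasGradWeightLE p (3 * n - 2) fun x => ‖clearedField p ζ x‖ ^ 2 := by
  let β : Fin n → Fin n → Fin n → ℕ := fun i j l =>
    (if l = i then 0 else 3) + (if l = j then 0 else 3)
  let m : (Fin n → ℕ) → E3 → ℝ := fun γ x => ∏ l, ‖x - p l‖ ^ γ l
  have hsum : ∀ i j, ∑ l, β i j l = 6 * (n - 1) := fun i j => by
    simp only [β, sum_add_distrib, sum_ite_eq_zero_three]
    omega
  have hm0 : ∀ i j, HasGradWeightLE p (3 * n - 2) (m (β i j)) := fun i j => by
    refine hasGradWeightLE_prod_norm_sub_pow ?_ ?_ fun l => ?_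
    · rw [hsum]
      exact ⟨3 * (n - 1), by omega⟩
    · rw [hsum]
      omega
    · simp only [β]
      split_ifs <;> simp
  have hm : ∀ i j k, k = i ∨ k = j →
      HasGradWeightLE p (3 * n - 2) (m (β i j + Pi.single k 2)) := fun i j k hk => by
    have hs : ∑ l, (β i j + Pi.single k 2 : Fin n → ℕ) l = 6 * (n - 1) + 2 := by
      simp [sum_add_distrib, hsum]
    refine hasGradWeightLE_prod_norm_sub_pow ?_ ?_ fun l => ?_
    · rw [hs]
      exact ⟨3 * (n - 1) + 1, by omega⟩
    · rw [hs]
      omega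
    · simp only [β, Pi.add_apply, Pi.single_apply]
      split_ifs <;> simp
  have hkey : (fun x => ‖clearedField p ζ x‖ ^ 2) = ∑ i, ∑ j, (ζ i * ζ j / 2) •
      (m (β i j + Pi.single i 2) + m (β i j + Pi.single j 2)
        + (-‖p i - p j‖ ^ 2) • m (β i j)) := by
    ext x
    rw [← real_inner_self_eq_norm_sq, clearedField]
    simp only [sum_inner, inner_sum, Finset.sum_apply, real_inner_smul_left,
      real_inner_smul_right]
    refine sum_congr rfl fun i _ => sum_congr rfl fun j _ => ?_
    have hβ : (∏ l ∈ univ.erase i, ‖x - p l‖ ^ 3) * (∏ l ∈ univ.erase j, ‖x - p l‖ ^ 3)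
        = m (β i j) x := by
      simp only [prod_erase_norm_sub_pow, m, β, pow_add, prod_mul_distrib]
    have hpol : inner ℝ (x - p i) (x - p j)
        = (‖x - p i‖ ^ 2 + ‖x - p j‖ ^ 2 - ‖p i - p j‖ ^ 2) / 2 := by
      have := norm_sub_sq_real (x - p i) (x - p j)
      rw [sub_sub_sub_cancel_left, norm_sub_rev] at this
      linarith
    have hmul : ∀ k, m (β i j + Pi.single k 2) x = m (β i j) x * ‖x - p k‖ ^ 2 := fun k =>
      (prod_norm_sub_pow_mul_sq x (β i j) k).symm
    simp only [Pi.smul_apply, Pi.add_apply, smul_eq_mul, hmul]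
    rw [real_inner_comm, hpol, ← hβ]
    ring
  rw [hkey]
  exact HasGradWeightLE.sum _ fun i _ => HasGradWeightLE.sum _ fun j _ =>
    (((hm i j i (.inl rfl)).add (hm i j j (.inr rfl))).add ((hm0 i j).const_smul _)).const_smul _

lemma mem_critSet_iff {ζ : Fin n → ℝ} {x : E3} (hx : ∀ i, x ≠ p i) :
    x ∈ critSet p ζ ↔ clearedField p ζ x = 0 := by
  have hr : ∀ i, ‖x - p i‖ ≠ 0 := fun i => norm_ne_zero_iff.2 (sub_ne_zero.2 (hx i))
  have hd : HasFDerivAt (pot p ζ)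
      (-innerSL ℝ (∑ i, (ζ i * (‖x - p i‖ ^ 3)⁻¹) • (x - p i))) x := by
    have h1 : HasFDerivAt (fun y => ∑ i, ζ i * ‖y - p i‖⁻¹) _ x := HasFDerivAt.fun_sum
      (u := univ) fun i _ => ((hasDerivAt_inv (hr i)).comp_hasFDerivAt x (hasFDerivAt_norm_sub (hx i))).const_mul (ζ i)
    simp only [← div_eq_mul_inv] at h1
    refine h1.congr_fderiv ?_
    rw [map_sum, ← sum_neg_distrib]
    refine sum_congr rfl fun i _ => ?_
    ext v
    have := hr i
    simp
    field_simp
  have hF : clearedField p ζ x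
      = (∏ l, ‖x - p l‖ ^ 3) • ∑ i, (ζ i * (‖x - p i‖ ^ 3)⁻¹) • (x - p i) := by
    rw [clearedField, smul_sum]
    refine sum_congr rfl fun i _ => ?_
    rw [smul_smul, ← mul_prod_erase univ (fun l => ‖x - p l‖ ^ 3) (mem_univ i)]
    have := hr i
    congr 1
    field_simp
  have hprod : ∏ l, ‖x - p l‖ ^ 3 ≠ 0 := prod_ne_zero_iff.2 fun l _ => pow_ne_zero _ (hr l)
  rw [hF, smul_eq_zero_iff_right hprod, critSet, Set.mem_ofPred_eq, hd.fderiv, neg_eq_zero]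
  refine ⟨fun h => ?_, fun h => ⟨hx, by rw [h, map_zero]⟩⟩
  rw [← norm_eq_zero, ← innerSL_apply_norm ℝ, h.2, norm_zero]

/-! ### Persistence of strict minima and generic regularity -/

lemma eventually_exists_isLocalMin_sub_inner {E : Type*} [NormedAddCommGroup E]
    [InnerProductSpace ℝ E] [ProperSpace E] {g : E → ℝ} (hg : Continuous g) {x : E} {ρ : ℝ}
    (hρ : 0 < ρ) (hpos : ∀ y ∈ Metric.sphere x ρ, g x < g y) :
    ∀ᶠ c in nhds (0 : E), ∃ z ∈ Metric.ball x ρ, IsLocalMin (fun y => g y - inner ℝ c y) z := by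
  obtain ⟨m, hm, hle⟩ := (isCompact_sphere x ρ).exists_forall_le' hg.continuousOn hpos
  filter_upwards [Metric.ball_mem_nhds (0 : E) (div_pos (sub_pos.2 hm) hρ)] with c hc
  rw [mem_ball_zero_iff, lt_div_iff₀ hρ] at hc
  refine Metric.exists_isLocalMin_mem_ball (z := x) (by fun_prop)
    (Metric.mem_closedBall_self hρ.le) fun y hy => ?_
  have h1 := real_inner_le_norm c (y - x)
  rw [inner_sub_right, mem_sphere_iff_norm.1 hy] at h1
  linarith [hle y hy]

lemma frequently_forall_det_fderiv_ne_zero {E : Type*} [NormedAddCommGroup E] [NormedSpace ℝ E]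
    [FiniteDimensional ℝ E] {f : E → E} {f' : E → E →L[ℝ] E} {s : Set E}
    (hf : ∀ x ∈ s, HasFDerivAt f (f' x) x) (a : E) :
    ∃ᶠ c in nhds a, ∀ x ∈ s, f x = c → (f' x).det ≠ 0 := by
  borelize E
  intro hev
  let μ : MeasureTheory.Measure E := MeasureTheory.Measure.addHaar
  have h0 := MeasureTheory.addHaar_image_eq_zero_of_det_fderivWithin_eq_zero μ
    (s := {x ∈ s | (f' x).det = 0}) (fun x hx => (hf x hx.1).hasFDerivWithinAt) fun x hx => hx.2
  refine (MeasureTheory.Measure.measure_pos_of_mem_nhds μ hev).ne' (MeasureTheory.measure_mono_null ?_ h0)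
  intro c hc
  simp only [Set.mem_ofPred_eq, not_forall, not_not] at hc
  obtain ⟨x, hx, hxc, hdet⟩ := hc
  exact ⟨x, ⟨hx, hdet⟩, hxc⟩

/-! ### The bound -/

lemma eventually_exists_perturbed_zero {ζ : Fin n → ℝ} {h : Fin 3 → E3 → ℝ}
    (hh : ∀ x, (∀ i, x ≠ p i) → HasFDerivAt (fun y => ‖clearedField p ζ y‖ ^ 2)
      (∑ k, h k x • (EuclideanSpace.proj k : E3 →L[ℝ] ℝ)) x)
    {x : E3} (hx : x ∈ isoCritSet p ζ) {U : Set E3} (hU : U ∈ nhds x) :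
    ∀ᶠ c in nhds (0 : E3), ∃ z ∈ U, (∀ i, z ≠ p i) ∧ ∀ k, h k z = c k := by
  obtain ⟨hxc, W, hW, hWx⟩ := hx
  have hoff : ∀ᶠ y in nhds x, ∀ i, y ≠ p i :=
    Filter.eventually_all.2 fun i => isOpen_ne.mem_nhds (hxc.1 i)
  obtain ⟨ρ, hρ, hball⟩ := Metric.nhds_basis_closedBall.mem_iff.1
    (Filter.inter_mem hU (Filter.inter_mem hW hoff))
  have h0 : clearedField p ζ x = 0 := (mem_critSet_iff hxc.1).1 hxc
  have hpos : ∀ y ∈ Metric.sphere x ρ, ‖clearedField p ζ x‖ ^ 2 < ‖clearedField p ζ y‖ ^ 2 := by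
    intro y hy
    obtain ⟨-, hyW, hyp⟩ := hball (Metric.sphere_subset_closedBall hy)
    have hne : clearedField p ζ y ≠ 0 := fun h =>
      Metric.ne_of_mem_sphere hy hρ.ne' (hWx y hyW ((mem_critSet_iff hyp).2 h))
    simpa [h0] using pow_pos (norm_pos_iff.2 hne) 2
  filter_upwards [eventually_exists_isLocalMin_sub_inner
    ((continuous_clearedField ζ).norm.pow 2) hρ hpos] with c ⟨z, hz, hmin⟩
  obtain ⟨hzU, -, hzp⟩ := hball (Metric.ball_subset_closedBall hz)
  refine ⟨z, hzU, hzp, fun k => ?_⟩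
  have hd := hmin.hasFDerivAt_eq_zero ((hh z hzp).sub (innerSL ℝ c).hasFDerivAt)
  have := congrArg (fun L : E3 →L[ℝ] ℝ => L (EuclideanSpace.single k 1)) hd
  simpa [_root_.sum_apply, sub_eq_zero, Pi.single_apply, EuclideanSpace.inner_single_right] using this

lemma card_le_of_subset_isoCritSet (hn : 1 ≤ n) {ζ : Fin n → ℝ} {T : Finset E3}
    (hT : (T : Set E3) ⊆ isoCritSet p ζ) : #T ≤ 2 ^ n * (3 * n - 2) ^ 3 := by
  classical
  obtain ⟨h, hw, hh⟩ := hasGradWeightLE_norm_clearedField_sq (p := p) hn ζ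
  obtain ⟨U, hU, hdisj⟩ := T.finite_toSet.t2_separation
  have hev : ∀ᶠ c in nhds (0 : E3), ∀ x ∈ T, ∃ z ∈ U x, (∀ i, z ≠ p i) ∧ ∀ k, h k z = c k :=
    (Filter.eventually_all_finset T).2 fun x hx =>
      eventually_exists_perturbed_zero hh (hT hx) ((hU x).2.mem_nhds (hU x).1)
  let e : E3 ≃L[ℝ] (Fin 3 → ℝ) := EuclideanSpace.equiv (Fin 3) ℝ
  let H : E3 → Fin 3 → ℝ := fun x k => h k x
  have hH : ∀ x, (∀ i, x ≠ p i) → DifferentiableAt ℝ H x := fun x hx =>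
    differentiableAt_pi.2 fun k => differentiableAt_of_mem_weightLE (hw k) hx
  obtain ⟨c, hreg, hc⟩ := ((frequently_forall_det_fderiv_ne_zero (f := fun x => e.symm (H x))
    (f' := fun x => (e.symm : (Fin 3 → ℝ) →L[ℝ] E3) ∘L fderiv ℝ H x) (s := {x | ∀ i, x ≠ p i})
    (fun x hx => e.symm.hasFDerivAt.comp x (hH x hx).hasFDerivAt) 0).and_eventually hev).exists
  choose! z hzU hzp hzc using hc
  have hinj : Set.InjOn z T := fun x hx y hy hxy => by
    by_contra hne
    exact Set.disjoint_left.1 (hdisj hx hy hne) (hzU x hx) (hxy ▸ hzU y hy)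
  rw [← card_image_of_injOn hinj]
  refine card_nondegenerate_zeros_le hn (f := fun k => h k - fun _ => c k)
    (fun k => (weightLE p _).sub_mem (hw k) (const_mem_weightLE _ _)) _ ?_ ?_
  · intro y hy k
    obtain ⟨x, hx, rfl⟩ := mem_image.1 hy
    simp [hzc x hx k]
  · intro y hy
    obtain ⟨x, hx, rfl⟩ := mem_image.1 hy
    refine ⟨fderiv ℝ H (z x), (hH _ (hzp x hx)).hasFDerivAt.sub_const (fun k => c k), ?_⟩
    have hdet := hreg (z x) (hzp x hx) (by
      rw [ContinuousLinearEquiv.symm_apply_eq]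
      exact funext (hzc x hx))
    have hs : Function.Surjective
        ((e.symm : (Fin 3 → ℝ) →L[ℝ] E3) ∘L fderiv ℝ H (z x)) :=
      (LinearMap.equivOfDetNeZero _ hdet).surjective
    intro v
    obtain ⟨w, hw⟩ := hs (e.symm v)
    exact ⟨w, e.symm.injective hw⟩

end Helpers

/-- under the stated genericity condition, the number of isolated
critical points of `V` is at most `2 ^ n * (3 * n - 2) ^ 3`. -/
theorem stmt0 (n : ℕ) (hn : 1 ≤ n) (p : Fin n → E3) (hp : Function.Injective p)
    (ζ : Fin n → ℝ) (hζ : ∀ i, ζ i ≠ 0)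
    (hgen : ∀ x ∈ critSet p ζ,
      ∑ i, ζ i * ∏ ℓ ∈ Finset.univ.erase i, ‖x - p ℓ‖ ^ 3 ≠ 0) :
    (isoCritSet p ζ).Finite ∧ (isoCritSet p ζ).ncard ≤ 2 ^ n * (3 * n - 2) ^ 3 := by
  have hfin : (isoCritSet p ζ).Finite := by
    by_contra hinf
    obtain ⟨T, hT, hcard⟩ := Set.Infinite.exists_subset_card_eq hinf (2 ^ n * (3 * n - 2) ^ 3 + 1)
    have := card_le_of_subset_isoCritSet hn hT
    omega
  refine ⟨hfin, ?_⟩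
  rw [Set.ncard_eq_toFinset_card _ hfin]
  exact card_le_of_subset_isoCritSet (p := p) (ζ := ζ) hn (by simp)
end
end

section
/- Let p_1, …, p_n be distinct points in ℝ³, ζ_1, …, ζ_n ∈ ℝ ∖ {0}, and let 𝒫 : ℝ³ × ℝⁿ → ℝ³ × ℝⁿ be the polynomial map with components ℛ_j(x,u) = Σ_{i=1}^n ζ_i (x_j − p_{ij}) ∏_{ℓ≠i} u_ℓ³ (j = 1,2,3) and 𝒬_m(x,u) = u_m² − ‖x − p_m‖² (m = 1, …, n). Suppose x ∈ ℝ³ ∖ {p_1, …, p_n} is a critical point of V(x) = Σ_{i=1}^n ζ_i/‖x − p_i‖, set r = (‖x − p_1‖, …, ‖x − p_n‖), and assume Σ_{i=1}^n ζ_i ∏_{ℓ≠i} ‖x − p_ℓ‖³ ≠ 0. Then (x, r) is an isolated zero of 𝒫, i.e. there is a neighbourhood of (x, r) in ℝ³ × ℝⁿ containing no other zero of 𝒫. -/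
noncomputable section

open Finset

/-- The polynomial `ℛ_j(x,u) = ∑ i, ζ i (x_j - p_{ij}) ∏_{ℓ ≠ i} u_ℓ³`. -/
def Rpoly {n : ℕ} (p : Fin n → E3) (ζ : Fin n → ℝ) (j : Fin 3) (x : E3)
    (u : Fin n → ℝ) : ℝ :=
  ∑ i, ζ i * (x j - p i j) * ∏ ℓ ∈ Finset.univ.erase i, u ℓ ^ 3

/-- The polynomial `𝒬_m(x,u) = u_m² - ‖x - p_m‖²`. -/
def Qpoly {n : ℕ} (p : Fin n → E3) (m : Fin n) (x : E3) (u : Fin n → ℝ) : ℝ :=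
  u m ^ 2 - ‖x - p m‖ ^ 2

/-- The polynomial map `𝒫 : ℝ³ × ℝⁿ → ℝ³ × ℝⁿ` with components `ℛ_j` and `𝒬_m`. -/
def Ppoly {n : ℕ} (p : Fin n → E3) (ζ : Fin n → ℝ) :
    E3 × (Fin n → ℝ) → (Fin 3 → ℝ) × (Fin n → ℝ) :=
  fun z => (fun j => Rpoly p ζ j z.1 z.2, fun m => Qpoly p m z.1 z.2)

/-- Real vectors `e l` are recovered linearly from their inner products with the family. -/
theorem exists_dual_frame {ι κ : Type*} [Fintype κ] (s : Finset ι) (e : ι → κ → ℝ) :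
    ∃ f : ι → κ → ℝ, ∀ l ∈ s, ∀ k, e l k = ∑ i ∈ s, (∑ m, e l m * e i m) * f i k := by
  classical
  let E := Submodule.span ℝ (e '' s)
  let T : E →ₗ[ℝ] (s → ℝ) := LinearMap.pi fun i =>
    (∑ m, (e i m) • LinearMap.proj m : (κ → ℝ) →ₗ[ℝ] ℝ) ∘ₗ E.subtype
  have hT : ∀ (v : E) (i : s), T v i = ∑ m, e i m * v.1 m := fun v i => by
    simp [T]
  have hker : LinearMap.ker T = ⊥ := by
    rw [LinearMap.ker_eq_bot']
    intro v hv
    have key : ∀ w ∈ E, ∑ m, w m * v.1 m = 0 := by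
      intro w hw
      induction hw using Submodule.span_induction with
      | mem w hw =>
        obtain ⟨i, hi, rfl⟩ := hw
        have := hT v ⟨i, hi⟩
        rw [hv] at this
        simpa using this.symm
      | zero => simp
      | add a b _ _ ha hb => simp [add_mul, Finset.sum_add_distrib, ha, hb]
      | smul c a _ ha => simp [mul_assoc, ← Finset.mul_sum, ha]
    have h0 := key v.1 v.2
    rw [Finset.sum_eq_zero_iff_of_nonneg fun m _ => mul_self_nonneg _] at h0
    ext m
    simpa using h0 m (Finset.mem_univ m)
  obtain ⟨g, hg⟩ := T.exists_leftInverse_of_injective hker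
  refine ⟨fun i k => if h : i ∈ s then (g (Pi.single ⟨i, h⟩ 1)).1 k else 0, fun l hl k => ?_⟩
  let v : E := ⟨e l, Submodule.subset_span ⟨l, hl, rfl⟩⟩
  have h1 : g (T v) = v := by simpa using LinearMap.congr_fun hg v
  have h2 : T v = ∑ i : s, T v i • Pi.single i (1 : ℝ) := by
    ext j
    simp [Finset.sum_apply, Pi.single_apply]
  have h3 : (g (T v)).1 k = ∑ i : s, T v i * (g (Pi.single i 1)).1 k := by
    conv_lhs => rw [h2]
    simp only [map_sum, map_smul, Submodule.coe_sum, Finset.sum_apply, Submodule.coe_smul,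
      Pi.smul_apply, smul_eq_mul]
  rw [h1] at h3
  rw [← Finset.sum_coe_sort s]
  simp only [Finset.coe_mem, dif_pos]
  refine h3.trans (Finset.sum_congr rfl fun i _ => ?_)
  rw [hT]
  simp [v, mul_comm]

section Valuation

variable {K Γ ι κ : Type*} [Field K] [Algebra ℝ K] [LinearOrderedCommGroupWithZero Γ]

theorem Valuation.eq_zero_of_map_algebraMap_lt_one {v : Valuation K Γ}
    (hv : ∀ c : ℝ, v (algebraMap ℝ K c) ≤ 1) {c : ℝ} (hc : v (algebraMap ℝ K c) < 1) : c = 0 := by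
  by_contra h
  have h1 : algebraMap ℝ K c * algebraMap ℝ K c⁻¹ = 1 := by
    rw [← map_mul, mul_inv_cancel₀ h, map_one]
  have h2 := congrArg v h1
  rw [map_mul, map_one] at h2
  exact (mul_lt_one_of_lt_of_le hc (hv c⁻¹)).ne h2

variable {p : ι → κ → ℝ} {ζ : ι → ℝ} {x : κ → K} {r : ι → K}

theorem sum_mul_sub_eq [Fintype κ]
    (hr : ∀ i, r i ^ 2 = ∑ k, (x k - algebraMap ℝ K (p i k)) ^ 2) (i j : ι) :
    2 * ∑ k, (x k - algebraMap ℝ K (p j k)) * algebraMap ℝ K (p i k - p j k) =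
      algebraMap ℝ K (∑ k, (p i k - p j k) ^ 2) + r j ^ 2 - r i ^ 2 := by
  rw [hr, hr, map_sum, ← Finset.sum_add_distrib, ← Finset.sum_sub_distrib, Finset.mul_sum]
  refine Finset.sum_congr rfl fun k _ => ?_
  simp only [map_sub, map_pow]
  ring

theorem sum_div_mul_sub_eq [Fintype ι]
    (hcrit : ∀ k, ∑ i, algebraMap ℝ K (ζ i) / r i ^ 3 * (x k - algebraMap ℝ K (p i k)) = 0)
    (j : ι) (k : κ) :
    (∑ i, algebraMap ℝ K (ζ i) / r i ^ 3) * (x k - algebraMap ℝ K (p j k)) =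
      ∑ i, algebraMap ℝ K (ζ i) / r i ^ 3 * algebraMap ℝ K (p i k - p j k) := by
  rw [← sub_zero (∑ i, algebraMap ℝ K (ζ i) / r i ^ 3 * algebraMap ℝ K (p i k - p j k)),
    ← neg_zero, ← hcrit k, Finset.sum_mul, ← Finset.sum_neg_distrib, ← Finset.sum_sub_distrib]
  refine Finset.sum_congr rfl fun i _ => ?_
  simp only [map_sub]
  ring

theorem Valuation.map_div_pow_le_one {v : Valuation K Γ}
    (hv : ∀ c : ℝ, v (algebraMap ℝ K c) ≤ 1) {a : K} (ha : 1 ≤ v a) (c : ℝ) (m : ℕ) :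
    v (algebraMap ℝ K c / a ^ m) ≤ 1 := by
  rw [map_div₀, map_pow]
  exact div_le_one_of_le₀ ((hv c).trans (one_le_pow₀ ha)) zero_le

variable [Fintype ι] [Fintype κ]

/-- If `x` is infinitesimally close to the isotropic cone of `p j`, then, with `S` the sum of the
coefficients `ζ i / r i ^ 3`, the vector `S • (x - p j)` is `S` times a vector infinitely close to a
real one, up to a bounded error. -/
theorem exists_sum_mul_sub_eq {v : Valuation K Γ}
    (hv : ∀ c : ℝ, v (algebraMap ℝ K c) ≤ 1)
    (hr : ∀ i, r i ^ 2 = ∑ k, (x k - algebraMap ℝ K (p i k)) ^ 2)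
    (hcrit : ∀ k, ∑ i, algebraMap ℝ K (ζ i) / r i ^ 3 * (x k - algebraMap ℝ K (p i k)) = 0)
    {j : ι} (hj : v (r j) < 1) :
    ∃ (c : κ → ℝ) (b d : κ → K), (∀ k, v (b k) < 1) ∧ (∀ k, v (d k) ≤ 1) ∧
      ∀ k, (∑ i, algebraMap ℝ K (ζ i) / r i ^ 3) * (x k - algebraMap ℝ K (p j k)) =
        (∑ i, algebraMap ℝ K (ζ i) / r i ^ 3) * (algebraMap ℝ K (c k) + b k) + d k := by
  classical
  have : CharZero K := charZero_of_injective_algebraMap (algebraMap ℝ K).injective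
  have two : (2 : K) ≠ 0 := two_ne_zero
  set J := Finset.univ.filter fun i => v (r i) < 1 with hJ
  obtain ⟨f, hf⟩ := exists_dual_frame J fun i k => p i k - p j k
  set S := ∑ i, algebraMap ℝ K (ζ i) / r i ^ 3 with hS
  let z : κ → K := fun k =>
    ∑ i ∈ Jᶜ, algebraMap ℝ K (ζ i) / r i ^ 3 * algebraMap ℝ K (p i k - p j k)
  let y : κ → K := fun k =>
    ∑ i ∈ J, algebraMap ℝ K (ζ i) / r i ^ 3 * algebraMap ℝ K (p i k - p j k)
  have hz : ∀ k, v (z k) ≤ 1 := fun k => v.map_sum_le fun i hi => by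
    rw [map_mul]
    refine mul_le_one' (Valuation.map_div_pow_le_one hv ?_ _ _) (hv _)
    simpa [hJ] using hi
  have hyz : ∀ k, S * (x k - algebraMap ℝ K (p j k)) = y k + z k := fun k => by
    rw [hS, sum_div_mul_sub_eq hcrit, Finset.sum_add_sum_compl]
  have hy : ∀ k, y k = ∑ i ∈ J, algebraMap ℝ K (f i k) *
      ∑ m, y m * algebraMap ℝ K (p i m - p j m) := fun k => by
    have h1 : ∀ l ∈ J, algebraMap ℝ K (p l k - p j k) =
        ∑ i ∈ J, (∑ m, algebraMap ℝ K (p l m - p j m) * algebraMap ℝ K (p i m - p j m)) *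
          algebraMap ℝ K (f i k) := fun l hl => by
      rw [hf l hl k]
      simp only [map_sum, map_mul]
    calc y k = ∑ l ∈ J, algebraMap ℝ K (ζ l) / r l ^ 3 * ∑ i ∈ J,
          (∑ m, algebraMap ℝ K (p l m - p j m) * algebraMap ℝ K (p i m - p j m)) *
          algebraMap ℝ K (f i k) := Finset.sum_congr rfl fun l hl => by rw [← h1 l hl]
      _ = _ := by
        simp only [y, Finset.mul_sum, Finset.sum_mul]
        rw [Finset.sum_comm]
        refine Finset.sum_congr rfl fun i _ => ?_
        rw [Finset.sum_comm]
        refine Finset.sum_congr rfl fun m _ => Finset.sum_congr rfl fun l _ => ?_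
        ring
  have hye : ∀ i, ∑ m, y m * algebraMap ℝ K (p i m - p j m) =
      S * ((algebraMap ℝ K (∑ k, (p i k - p j k) ^ 2) + r j ^ 2 - r i ^ 2) / 2) -
        ∑ m, z m * algebraMap ℝ K (p i m - p j m) := fun i => by
    rw [← sum_mul_sub_eq hr i j, mul_div_cancel_left₀ _ two, Finset.mul_sum,
      ← Finset.sum_sub_distrib]
    refine Finset.sum_congr rfl fun m _ => ?_
    rw [← mul_assoc, hyz]
    ring
  have v2 : v (2⁻¹ : K) ≤ 1 := by
    have := hv 2⁻¹
    rwa [map_inv₀, map_ofNat] at this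
  refine ⟨fun k => ∑ i ∈ J, f i k * ((∑ k, (p i k - p j k) ^ 2) / 2),
    fun k => ∑ i ∈ J, algebraMap ℝ K (f i k) * ((r j ^ 2 - r i ^ 2) * 2⁻¹),
    fun k => z k - ∑ i ∈ J, algebraMap ℝ K (f i k) *
      ∑ m, z m * algebraMap ℝ K (p i m - p j m), fun k => ?_, fun k => ?_, fun k => ?_⟩
  · refine v.map_sum_lt one_ne_zero fun i hi => ?_
    have hi : v (r i) < 1 := by simpa [hJ] using hi
    rw [map_mul, map_mul]
    refine mul_lt_one_of_nonneg_of_lt_one_right (hv _) zero_le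
      (mul_lt_one_of_lt_of_le (v.map_sub_lt ?_ ?_) v2)
    · rw [map_pow]; exact pow_lt_one₀ zero_le hj two_ne_zero
    · rw [map_pow]; exact pow_lt_one₀ zero_le hi two_ne_zero
  · refine v.map_sub_le (hz k) (v.map_sum_le fun i _ => ?_)
    rw [map_mul]
    refine mul_le_one' (hv _) (v.map_sum_le fun m _ => ?_)
    rw [map_mul]
    exact mul_le_one' (hz m) (hv _)
  · rw [hyz, hy]
    simp_rw [hye]
    have : ∑ i ∈ J, algebraMap ℝ K (f i k) *
        (S * ((algebraMap ℝ K (∑ k, (p i k - p j k) ^ 2) + r j ^ 2 - r i ^ 2) / 2)) =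
        S * (algebraMap ℝ K (∑ i ∈ J, f i k * ((∑ k, (p i k - p j k) ^ 2) / 2)) +
          ∑ i ∈ J, algebraMap ℝ K (f i k) * ((r j ^ 2 - r i ^ 2) * 2⁻¹)) := by
      rw [map_sum, ← Finset.sum_add_distrib, Finset.mul_sum]
      refine Finset.sum_congr rfl fun i _ => ?_
      rw [map_mul, map_div₀, map_ofNat]
      ring
    rw [Finset.sum_congr rfl fun i _ => mul_sub _ _ _, Finset.sum_sub_distrib, this]
    ring

/-- At any place where `∑ i, ζ i / r i ^ 3` does not vanish, the critical point is finite. -/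
theorem map_coord_le_one {v : Valuation K Γ}
    (hv : ∀ c : ℝ, v (algebraMap ℝ K c) ≤ 1)
    (hr : ∀ i, r i ^ 2 = ∑ k, (x k - algebraMap ℝ K (p i k)) ^ 2)
    (hcrit : ∀ k, ∑ i, algebraMap ℝ K (ζ i) / r i ^ 3 * (x k - algebraMap ℝ K (p i k)) = 0)
    (hS : 1 ≤ v (∑ i, algebraMap ℝ K (ζ i) / r i ^ 3)) (k : κ) : v (x k) ≤ 1 := by
  set S := ∑ i, algebraMap ℝ K (ζ i) / r i ^ 3 with hSdef
  have hS0 : S ≠ 0 := fun h => by simp [h] at hS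
  have hdiv : ∀ d, v d ≤ 1 → v (d / S) ≤ 1 := fun d hd => by
    rw [map_div₀]
    exact div_le_one_of_le₀ (hd.trans hS) zero_le
  by_cases hJ : ∃ j, v (r j) < 1
  · obtain ⟨j, hj⟩ := hJ
    obtain ⟨c, b, d, hb, hd, h⟩ := exists_sum_mul_sub_eq hv hr hcrit hj
    rw [← hSdef] at h
    have hx : x k = algebraMap ℝ K (c k) + b k + d k / S + algebraMap ℝ K (p j k) := by
      have := h k
      field_simp
      linear_combination this
    rw [hx]
    exact v.map_add_le (v.map_add_le (v.map_add_le (hv _) (hb k).le) (hdiv _ (hd k))) (hv _)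
  · push Not at hJ
    have hx : x k = (∑ i, algebraMap ℝ K (ζ i) / r i ^ 3 * algebraMap ℝ K (p i k)) / S := by
      have := hcrit k
      simp only [mul_sub, Finset.sum_sub_distrib, ← Finset.sum_mul] at this
      rw [eq_div_iff hS0]
      linear_combination this
    rw [hx]
    refine hdiv _ (v.map_sum_le fun i _ => ?_)
    rw [map_mul]
    exact mul_le_one' (Valuation.map_div_pow_le_one hv (hJ i) _ _) (hv _)

/-- The element `∑ i, ζ i / r i ^ 3` has no poles. -/
theorem map_sum_div_le_one {v : Valuation K Γ}
    (hv : ∀ c : ℝ, v (algebraMap ℝ K c) ≤ 1) (hp : Function.Injective p) (hζ : ∀ i, ζ i ≠ 0)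
    (hr0 : ∀ i, r i ≠ 0)
    (hr : ∀ i, r i ^ 2 = ∑ k, (x k - algebraMap ℝ K (p i k)) ^ 2)
    (hcrit : ∀ k, ∑ i, algebraMap ℝ K (ζ i) / r i ^ 3 * (x k - algebraMap ℝ K (p i k)) = 0) :
    v (∑ i, algebraMap ℝ K (ζ i) / r i ^ 3) ≤ 1 := by
  classical
  by_contra! hS
  by_cases hJ : ∃ j, v (r j) < 1
  swap
  · push Not at hJ
    exact hS.not_ge (v.map_sum_le fun i _ => Valuation.map_div_pow_le_one hv (hJ i) _ _)
  obtain ⟨j, hj⟩ := hJ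
  obtain ⟨c, b, d, hb, hd, h⟩ := exists_sum_mul_sub_eq hv hr hcrit hj
  have hprod := sum_div_mul_sub_eq hcrit j
  set S := ∑ i, algebraMap ℝ K (ζ i) / r i ^ 3 with hSdef
  have hS0 : S ≠ 0 := fun h => by simp [h] at hS
  have hsq : ∀ {a : K}, v a < 1 → v (a ^ 2) < 1 := fun ha => by
    rw [map_pow]
    exact pow_lt_one₀ zero_le ha two_ne_zero
  have hx : ∀ k, v (algebraMap ℝ K (c k) - (x k - algebraMap ℝ K (p j k))) < 1 := fun k => by
    have : algebraMap ℝ K (c k) - (x k - algebraMap ℝ K (p j k)) = - (b k + d k / S) := by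
      have := h k
      field_simp
      linear_combination -this
    rw [this, Valuation.map_neg]
    refine v.map_add_lt (hb k) ?_
    rw [map_div₀]
    exact (div_lt_one₀ (zero_lt_one.trans hS)).2 ((hd k).trans_lt hS)
  have hc2 : ∑ k, c k ^ 2 = 0 := by
    refine Valuation.eq_zero_of_map_algebraMap_lt_one hv ?_
    have : algebraMap ℝ K (∑ k, c k ^ 2) = r j ^ 2 +
        ∑ k, (algebraMap ℝ K (c k) - (x k - algebraMap ℝ K (p j k))) *
          (algebraMap ℝ K (2 * c k) -
            (algebraMap ℝ K (c k) - (x k - algebraMap ℝ K (p j k)))) := by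
      rw [hr, map_sum, ← Finset.sum_add_distrib]
      refine Finset.sum_congr rfl fun k _ => ?_
      rw [map_pow, map_mul, map_ofNat]
      ring
    rw [this]
    refine v.map_add_lt (hsq hj) (v.map_sum_lt one_ne_zero fun k _ => ?_)
    rw [map_mul]
    exact mul_lt_one_of_lt_of_le (hx k) (v.map_sub_le (hv _) (hx k).le)
  have hxj : ∀ k, v (x k - algebraMap ℝ K (p j k)) < 1 := fun k => by
    have hck : c k = 0 := by
      rw [Finset.sum_eq_zero_iff_of_nonneg fun k _ => sq_nonneg _] at hc2
      simpa using hc2 k (Finset.mem_univ k)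
    simpa [hck, Valuation.map_sub_swap] using hx k
  have huniq : ∀ i, i ≠ j → 1 ≤ v (r i) := fun i hij => by
    by_contra! hi
    refine hij (hp (funext fun k => ?_))
    have h0 : ∑ k, (p i k - p j k) ^ 2 = 0 := by
      refine Valuation.eq_zero_of_map_algebraMap_lt_one hv ?_
      have : algebraMap ℝ K (∑ k, (p i k - p j k) ^ 2) = algebraMap ℝ K 2 *
          ∑ k, (x k - algebraMap ℝ K (p j k)) * algebraMap ℝ K (p i k - p j k) +
            r i ^ 2 - r j ^ 2 := by
        rw [map_ofNat, sum_mul_sub_eq hr]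
        ring
      rw [this]
      refine v.map_sub_lt (v.map_add_lt ?_ (hsq hi)) (hsq hj)
      rw [map_mul]
      refine mul_lt_one_of_nonneg_of_lt_one_right (hv _) zero_le
        (v.map_sum_lt one_ne_zero fun k _ => ?_)
      rw [map_mul]
      exact mul_lt_one_of_lt_of_le (hxj k) (hv _)
    rw [Finset.sum_eq_zero_iff_of_nonneg fun k _ => sq_nonneg _] at h0
    have := h0 k (Finset.mem_univ k)
    rwa [sq_eq_zero_iff, sub_eq_zero] at this
  have hSx : ∀ k, v (S * (x k - algebraMap ℝ K (p j k))) ≤ 1 := fun k => by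
    rw [hprod]
    refine v.map_sum_le fun i _ => ?_
    rcases eq_or_ne i j with rfl | hij
    · simp
    · rw [map_mul]
      exact mul_le_one' (Valuation.map_div_pow_le_one hv (huniq i hij) _ _) (hv _)
  have hSr : v (S * r j) ≤ 1 := by
    have : v ((S * r j) ^ 2) ≤ 1 := by
      rw [mul_pow, hr, Finset.mul_sum]
      refine v.map_sum_le fun k _ => ?_
      rw [← mul_pow, map_pow]
      exact pow_le_one' (hSx k) 2
    rw [map_pow] at this
    exact (pow_le_one_iff_of_nonneg zero_le two_ne_zero).1 this
  have hζj : v (algebraMap ℝ K (ζ j) / r j ^ 2) ≤ 1 := by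
    have : algebraMap ℝ K (ζ j) / r j ^ 2 = S * r j -
        (∑ i ∈ Finset.univ.erase j, algebraMap ℝ K (ζ i) / r i ^ 3) * r j := by
      rw [hSdef, ← Finset.add_sum_erase _ _ (Finset.mem_univ j)]
      have := hr0 j
      field_simp
      ring
    rw [this]
    refine v.map_sub_le hSr ?_
    rw [map_mul]
    exact mul_le_one' (v.map_sum_le fun i hi =>
      Valuation.map_div_pow_le_one hv (huniq i (Finset.ne_of_mem_erase hi)) _ _) hj.le
  refine hζ j (Valuation.eq_zero_of_map_algebraMap_lt_one hv ?_)
  have : algebraMap ℝ K (ζ j) = algebraMap ℝ K (ζ j) / r j ^ 2 * r j ^ 2 :=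
    (div_mul_cancel₀ _ (pow_ne_zero 2 (hr0 j))).symm
  rw [this, map_mul]
  exact mul_lt_one_of_nonneg_of_lt_one_right hζj zero_le (hsq hj)

end Valuation

theorem isIntegral_of_forall_valuationSubring {R K : Type*} [CommRing R] [Field K] [Algebra R K]
    {a : K} (h : ∀ A : ValuationSubring K, (∀ c : R, algebraMap R K c ∈ A) → a ∈ A) :
    IsIntegral R a := by
  by_contra ha
  have : IsIntegrallyClosedIn (integralClosure R K).toSubring K :=
    inferInstanceAs (IsIntegrallyClosedIn (integralClosure R K) K)
  obtain ⟨A, hA, haA⟩ := Subring.exists_le_valuationSubring_of_isIntegrallyClosedIn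
    (R := (integralClosure R K).toSubring) (x := a) ha
  exact haA (h A fun c => hA (isIntegral_algebraMap : IsIntegral R (algebraMap R K c)))

/-- A critical point over an extension field of `ℝ` with `∑ i, ζ i / r i ^ 3 ≠ 0` has coordinates
integral over `ℝ`. -/
theorem isIntegral_coord {K ι κ : Type*} [Field K] [Algebra ℝ K] [Fintype ι] [Fintype κ]
    {p : ι → κ → ℝ} {ζ : ι → ℝ} {x : κ → K} {r : ι → K}
    (hp : Function.Injective p) (hζ : ∀ i, ζ i ≠ 0) (hr0 : ∀ i, r i ≠ 0)
    (hr : ∀ i, r i ^ 2 = ∑ k, (x k - algebraMap ℝ K (p i k)) ^ 2)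
    (hcrit : ∀ k, ∑ i, algebraMap ℝ K (ζ i) / r i ^ 3 * (x k - algebraMap ℝ K (p i k)) = 0)
    (hS : ∑ i, algebraMap ℝ K (ζ i) / r i ^ 3 ≠ 0) (k : κ) : IsIntegral ℝ (x k) := by
  have hSint : IsIntegral ℝ (∑ i, algebraMap ℝ K (ζ i) / r i ^ 3) :=
    isIntegral_of_forall_valuationSubring fun A hA => (A.valuation_le_one_iff _).1 <|
      map_sum_div_le_one (fun c => (A.valuation_le_one_iff _).2 (hA c)) hp hζ hr0 hr hcrit
  refine isIntegral_of_forall_valuationSubring fun A hA => (A.valuation_le_one_iff _).1 <|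
    map_coord_le_one (fun c => (A.valuation_le_one_iff _).2 (hA c)) hr hcrit ?_ k
  have hinv : (∑ i, algebraMap ℝ K (ζ i) / r i ^ 3)⁻¹ ∈ A := by
    let φ : ℝ →+* A := (algebraMap ℝ K).codRestrict A.toSubring hA
    have h1 : IsIntegral ℝ (∑ i, algebraMap ℝ K (ζ i) / r i ^ 3)⁻¹ :=
      (hSint.isAlgebraic.inv).isIntegral
    obtain ⟨q, hq, hq0⟩ := h1
    have h2 : IsIntegral A (∑ i, algebraMap ℝ K (ζ i) / r i ^ 3)⁻¹ :=
      ⟨q.map φ, hq.map φ, by rw [Polynomial.eval₂_map]; exact hq0⟩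
    obtain ⟨a, ha⟩ := IsIntegrallyClosed.isIntegral_iff.1 h2
    rw [← ha]
    exact a.2
  have := (A.valuation_le_one_iff _).2 hinv
  rw [map_inv₀] at this
  exact (inv_le_one₀ (zero_lt_iff.2 (by simpa using hS))).1 this

theorem Ultrafilter.exists_field_quotient {α : Type} (U : Ultrafilter α) :
    ∃ (K : Type) (_ : Field K) (π : (α → ℝ) →+* K), ∀ f g, π f = π g ↔ ∀ᶠ z in U, f z = g z :=
  ⟨(U : Filter α).Germ ℝ, inferInstance, Filter.Germ.coeRingHom _, fun _ _ => Filter.Germ.coe_eq⟩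

theorem Ultrafilter.exists_eventually_eq_of_eval_eq_zero {α : Type*} (U : Ultrafilter α)
    {f : α → ℝ} {q : Polynomial ℝ} (hq : q ≠ 0) (h : ∀ᶠ z in U, q.eval (f z) = 0) :
    ∃ c, ∀ᶠ z in U, f z = c := by
  have hfin : (f ⁻¹' (q.roots.toFinset : Set ℝ)) ∈ U := by
    filter_upwards [h] with z hz
    simpa [hq] using hz
  have : f ⁻¹' (q.roots.toFinset : Set ℝ) = ⋃ c ∈ (q.roots.toFinset : Set ℝ), f ⁻¹' {c} := by
    ext; simp
  rw [this, Ultrafilter.finite_biUnion_mem_iff (Finset.finite_toSet _)] at hfin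
  obtain ⟨c, -, hc⟩ := hfin
  exact ⟨c, hc⟩

theorem prod_erase_pow_three {ι K : Type*} [Fintype ι] [DecidableEq ι] [Field K] {r : ι → K}
    (hr : ∀ i, r i ≠ 0) (i : ι) :
    ∏ l ∈ Finset.univ.erase i, r l ^ 3 = (∏ l, r l ^ 3) / r i ^ 3 := by
  rw [eq_div_iff (pow_ne_zero 3 (hr i)), Finset.prod_erase_mul _ _ (Finset.mem_univ i)]

theorem exists_eventually_coord_eq {n : ℕ} {p : Fin n → E3} (hp : Function.Injective p)
    {ζ : Fin n → ℝ} (hζ : ∀ i, ζ i ≠ 0) (U : Ultrafilter (E3 × (Fin n → ℝ)))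
    (hzero : ∀ᶠ z in (U : Filter (E3 × (Fin n → ℝ))), Ppoly p ζ z = 0) (hpos : ∀ i, ∀ᶠ z in (U : Filter (E3 × (Fin n → ℝ))), z.2 i ≠ 0)
    (hgen : ∀ᶠ z in (U : Filter (E3 × (Fin n → ℝ))), ∑ i, ζ i * ∏ ℓ ∈ Finset.univ.erase i, z.2 ℓ ^ 3 ≠ 0) (k : Fin 3) :
    ∃ c, ∀ᶠ z in (U : Filter (E3 × (Fin n → ℝ))), z.1 k = c := by
  obtain ⟨K, _, π, hπ⟩ := U.exists_field_quotient
  let : Algebra ℝ K := (π.comp (Pi.constRingHom _ ℝ)).toAlgebra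
  have hconst : ∀ c : ℝ, algebraMap ℝ K c = π fun _ => c := fun _ => rfl
  let x : Fin 3 → K := fun k => π fun z => z.1 k
  let r : Fin n → K := fun i => π fun z => z.2 i
  have hr0 : ∀ i, r i ≠ 0 := fun i h => by
    rw [← map_zero π, hπ] at h
    obtain ⟨z, hz, hz'⟩ := (h.and (hpos i)).exists
    exact hz' hz
  have hr : ∀ i, r i ^ 2 = ∑ k, (x k - algebraMap ℝ K (p i k)) ^ 2 := fun i => by
    simp only [r, x, hconst, ← map_sub, ← map_pow, ← map_sum, hπ]
    filter_upwards [hzero] with z hz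
    have := congrFun (congrArg Prod.snd hz) i
    simp only [Ppoly, Qpoly, EuclideanSpace.real_norm_sq_eq] at this
    simpa [sub_eq_zero, Finset.sum_apply] using this
  have hcrit : ∀ k, ∑ i, algebraMap ℝ K (ζ i) / r i ^ 3 * (x k - algebraMap ℝ K (p i k)) = 0 := by
    intro k
    have h : ∑ i, algebraMap ℝ K (ζ i) * (x k - algebraMap ℝ K (p i k)) *
        ∏ l ∈ Finset.univ.erase i, r l ^ 3 = 0 := by
      simp only [r, x, hconst, ← map_sub, ← map_mul, ← map_pow, ← map_prod, ← map_sum]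
      rw [← map_zero π, hπ]
      filter_upwards [hzero] with z hz
      have := congrFun (congrArg Prod.fst hz) k
      simpa [Ppoly, Rpoly, Finset.sum_apply, Finset.prod_apply] using this
    refine (mul_eq_zero.1 (?_ : (∏ l, r l ^ 3) * _ = 0)).resolve_left
      (Finset.prod_ne_zero_iff.2 fun l _ => pow_ne_zero 3 (hr0 l))
    rw [← h, Finset.mul_sum]
    refine Finset.sum_congr rfl fun i _ => ?_
    rw [prod_erase_pow_three hr0]
    ring
  have hS : ∑ i, algebraMap ℝ K (ζ i) / r i ^ 3 ≠ 0 := by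
    have h : ∑ i, algebraMap ℝ K (ζ i) * ∏ l ∈ Finset.univ.erase i, r l ^ 3 ≠ 0 := by
      simp only [r, hconst, ← map_mul, ← map_pow, ← map_prod, ← map_sum]
      rw [← map_zero π, Ne, hπ]
      intro h
      obtain ⟨z, hz, hz'⟩ := (h.and hgen).exists
      exact hz' (by simpa [Finset.sum_apply, Finset.prod_apply] using hz)
    refine right_ne_zero_of_mul (a := ∏ l, r l ^ 3) ?_
    convert h using 1
    rw [Finset.mul_sum]
    refine Finset.sum_congr rfl fun i _ => ?_
    rw [prod_erase_pow_three hr0]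
    ring
  have hp' : Function.Injective fun i k => p i k := fun i j hij =>
    hp (PiLp.ext fun k => congrFun hij k)
  obtain ⟨q, hq, hq0⟩ := isIntegral_coord hp' hζ hr0 hr hcrit hS k
  refine U.exists_eventually_eq_of_eval_eq_zero hq.ne_zero ?_
  have : π (fun z => q.eval (z.1 k)) = π 0 := by
    rw [map_zero, ← hq0, Polynomial.eval₂_eq_sum_range]
    simp only [x, hconst, ← map_pow, ← map_mul, ← map_sum, hπ]
    filter_upwards with z
    simp [Polynomial.eval_eq_sum_range, Finset.sum_apply]
  exact (hπ _ _).1 this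

/-- if `x` is a critical point of `V` at which the genericity quantity
`∑ i, ζ i ∏_{ℓ ≠ i} ‖x - p ℓ‖³` does not vanish, then `(x, r)` with
`r = (‖x - p 1‖, …, ‖x - p n‖)` is an isolated zero of `𝒫`. -/
theorem stmt3 (n : ℕ) (p : Fin n → E3) (hp : Function.Injective p)
    (ζ : Fin n → ℝ) (hζ : ∀ i, ζ i ≠ 0)
    (x : E3) (hx : ∀ i, x ≠ p i) (hcrit : fderiv ℝ (pot p ζ) x = 0)
    (hgen : ∑ i, ζ i * ∏ ℓ ∈ Finset.univ.erase i, ‖x - p ℓ‖ ^ 3 ≠ 0) :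
    ∃ U ∈ nhds ((x, fun i => ‖x - p i‖) : E3 × (Fin n → ℝ)),
      ∀ y ∈ U, Ppoly p ζ y = 0 → y = (x, fun i => ‖x - p i‖) := by
  set z₀ : E3 × (Fin n → ℝ) := (x, fun i => ‖x - p i‖) with hz₀
  by_contra! hcon
  have hne : (nhdsWithin z₀ {z₀}ᶜ ⊓ Filter.principal {z | Ppoly p ζ z = 0}).NeBot := by
    rw [← Filter.frequently_mem_iff_neBot, Filter.frequently_iff]
    intro V hV
    obtain ⟨W, hW, hWV⟩ := mem_nhdsWithin_iff_exists_mem_nhds_inter.1 hV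
    obtain ⟨y, hyW, hy, hyz⟩ := hcon W hW
    exact ⟨y, hWV ⟨hyW, hyz⟩, hy⟩
  let U := Ultrafilter.of (nhdsWithin z₀ {z₀}ᶜ ⊓ Filter.principal {z | Ppoly p ζ z = 0})
  have hU : (U : Filter _) ≤ nhdsWithin z₀ {z₀}ᶜ ⊓ Filter.principal {z | Ppoly p ζ z = 0} :=
    Ultrafilter.of_le _
  have hzero : ∀ᶠ z in (U : Filter (E3 × (Fin n → ℝ))), Ppoly p ζ z = 0 := (hU.trans inf_le_right) (Filter.mem_principal_self _)
  have hneq : ∀ᶠ z in (U : Filter (E3 × (Fin n → ℝ))), z ≠ z₀ := (hU.trans inf_le_left) self_mem_nhdsWithin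
  have hlim : (U : Filter _) ≤ nhds z₀ := hU.trans (inf_le_left.trans nhdsWithin_le_nhds)
  have hpos : ∀ i, ∀ᶠ z in (U : Filter (E3 × (Fin n → ℝ))), 0 < z.2 i := fun i => by
    have hc : Continuous fun z : E3 × (Fin n → ℝ) => z.2 i := by fun_prop
    exact hlim (hc.continuousAt.eventually_const_lt
      (norm_pos_iff.2 (sub_ne_zero.2 (hx i))))
  have hgen' : ∀ᶠ z in (U : Filter (E3 × (Fin n → ℝ))), ∑ i, ζ i * ∏ ℓ ∈ Finset.univ.erase i, z.2 ℓ ^ 3 ≠ 0 := by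
    have hc : Continuous fun z : E3 × (Fin n → ℝ) =>
        ∑ i, ζ i * ∏ ℓ ∈ Finset.univ.erase i, z.2 ℓ ^ 3 := by fun_prop
    exact hlim (hc.continuousAt.eventually_ne hgen)
  have hcoord : ∀ k, ∀ᶠ z in (U : Filter (E3 × (Fin n → ℝ))), z.1 k = x k := fun k => by
    obtain ⟨c, hc⟩ := exists_eventually_coord_eq hp hζ U hzero
      (fun i => (hpos i).mono fun z hz => hz.ne') hgen' k
    have hcont : Continuous fun z : E3 × (Fin n → ℝ) => z.1 k := by fun_prop
    have h1 : Filter.Tendsto (fun z : E3 × (Fin n → ℝ) => z.1 k) U (nhds (x k)) :=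
      (hcont.tendsto z₀).mono_left hlim
    have h2 : c = x k := tendsto_nhds_unique (tendsto_const_nhds.congr' (hc.mono fun _ h => h.symm)) h1
    rwa [h2] at hc
  obtain ⟨z, hz, hzP, hzc, hzp⟩ := (hneq.and (hzero.and
    ((Filter.eventually_all.2 hcoord).and (Filter.eventually_all.2 hpos)))).exists
  have hz1 : z.1 = x := PiLp.ext hzc
  refine hz (Prod.ext hz1 (funext fun i => ?_))
  have := congrFun (congrArg Prod.snd hzP) i
  simp only [Ppoly, Qpoly, hz1, Prod.snd_zero, Pi.zero_apply, sub_eq_zero] at this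
  exact (sq_eq_sq₀ (hzp i).le (norm_nonneg _)).1 this
end
end

section
/- Let A_1, …, A_n be distinct points in ℝ³ with charges ζ_1, …, ζ_n > 0, and let 0 < p < 1. Then V_p(x) = Σ_{i=1}^n (ζ_i/‖x − A_i‖)^p has no local minimum on ℝ³ ∖ {A_1, …, A_n}. Moreover, for p = 1, V_1 has neither local minima nor local maxima on its domain. -/
noncomputable section

open Finset

/-- The modified electrostatic potential `V_p(x) = ∑ i, ζ i ^ p / ‖x - A i‖ ^ p`
(real exponent `p`). -/
def Vp {n : ℕ} (A : Fin n → E3) (ζ : Fin n → ℝ) (p : ℝ) : E3 → ℝ :=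
  fun x => ∑ i, ζ i ^ p / ‖x - A i‖ ^ p

open Filter Topology Metric

lemma nonneg_of_isLocalMin_of_hasDerivAt {g g' : ℝ → ℝ} {a c : ℝ}
    (hg : ∀ᶠ t in 𝓝 a, HasDerivAt g (g' t) t) (hg' : HasDerivAt g' c a)
    (hmin : IsLocalMin g a) : 0 ≤ c := by
  by_contra! hc
  have hd : deriv g =ᶠ[𝓝 a] g' := hg.mono fun t ht => ht.deriv
  have hdd : deriv (deriv g) a = c := by rw [hd.deriv_eq, hg'.deriv]
  have hmax : IsLocalMax g a :=
    isLocalMax_of_deriv_deriv_neg (hdd ▸ hc) hmin.deriv_eq_zero hg.self_of_nhds.continuousAt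
  have hconst : g =ᶠ[𝓝 a] fun _ => g a := by
    filter_upwards [hmin, hmax] with t h₁ h₂ using le_antisymm h₂ h₁
  have hzero : deriv g =ᶠ[𝓝 a] fun _ => 0 := by
    simpa using hconst.deriv
  rw [hzero.deriv_eq, deriv_const] at hdd
  exact hc.ne hdd.symm

lemma exists_hasDerivAt_norm_rpow_line {x A : E3} (hx : x ≠ A) (e : E3) (p : ℝ) :
    ∃ g' : ℝ → ℝ,
      (∀ᶠ t in 𝓝 (0 : ℝ), HasDerivAt (fun t : ℝ => ‖x + t • e - A‖ ^ (-p)) (g' t) t) ∧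
      HasDerivAt g' (p * (p + 2) * ‖x - A‖ ^ (-p - 4) * inner ℝ (x - A) e ^ 2
        - p * ‖x - A‖ ^ (-p - 2) * ‖e‖ ^ 2) 0 := by
  have hpos : 0 < ‖x - A‖ := norm_pos_iff.2 (sub_ne_zero.2 hx)
  set q : ℝ → ℝ := fun t => ‖x - A‖ ^ 2 + 2 * t * inner ℝ (x - A) e + t ^ 2 * ‖e‖ ^ 2 with hq
  have hline : ∀ t : ℝ, ‖x + t • e - A‖ ^ 2 = q t := by
    intro t
    rw [show x + t • e - A = (x - A) + t • e by abel, norm_add_sq_real, inner_smul_right,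
      norm_smul, mul_pow, Real.norm_eq_abs, sq_abs]
    simp only [hq]; ring
  have hpow : ∀ (r : ℝ) (v : E3), ‖v‖ ^ r = (‖v‖ ^ 2) ^ (r / 2) := by
    intro r v
    rw [← Real.rpow_natCast, ← Real.rpow_mul (norm_nonneg _)]
    congr 1; push_cast; ring
  have hq' : ∀ t, HasDerivAt q (2 * inner ℝ (x - A) e + 2 * t * ‖e‖ ^ 2) t := by
    intro t
    have h₁ := ((hasDerivAt_id t).const_mul 2).mul_const (inner ℝ (x - A) e)
    have h₂ := ((hasDerivAt_id t).pow 2).mul_const (‖e‖ ^ 2)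
    exact ((h₁.const_add (‖x - A‖ ^ 2)).add h₂).congr_deriv (by simp)
  have hq0 : q 0 = ‖x - A‖ ^ 2 := by simp [hq]
  have hqpos : ∀ᶠ t in 𝓝 (0 : ℝ), q t ≠ 0 :=
    (hq' 0).continuousAt.eventually_ne (by rw [hq0]; positivity)
  refine ⟨fun t => (2 * inner ℝ (x - A) e + 2 * t * ‖e‖ ^ 2) * (-p / 2) * q t ^ (-p / 2 - 1),
    ?_, ?_⟩
  · filter_upwards [hqpos] with t ht
    simp_rw [hpow (-p), hline]
    exact (hq' t).rpow_const (Or.inl ht)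
  · have h₁ : HasDerivAt (fun t : ℝ => (2 * inner ℝ (x - A) e + 2 * t * ‖e‖ ^ 2) * (-p / 2))
        (2 * ‖e‖ ^ 2 * (-p / 2)) 0 := by
      have := ((((hasDerivAt_id (0 : ℝ)).const_mul 2).mul_const (‖e‖ ^ 2)).const_add
        (2 * inner ℝ (x - A) e)).mul_const (-p / 2)
      simpa using this
    have h₂ := (hq' 0).rpow_const (p := -p / 2 - 1) (Or.inl hqpos.self_of_nhds)
    refine (h₁.mul h₂).congr_deriv ?_
    rw [hq0, hpow (-p - 4), hpow (-p - 2), show -p / 2 - 1 - 1 = (-p - 4) / 2 by ring,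
      show -p / 2 - 1 = (-p - 2) / 2 by ring]
    ring

/-- At a local minimum of a finite combination of the functions `‖y - A i‖ ^ (-p i)`,
the Laplacian is nonnegative. -/
lemma laplacian_nonneg_of_isLocalMin {ι : Type*} [Fintype ι] {c p : ι → ℝ} {A : ι → E3} {x : E3}
    (hx : ∀ i, x ≠ A i) (hmin : IsLocalMin (fun y => ∑ i, c i * ‖y - A i‖ ^ (-p i)) x) :
    0 ≤ ∑ i, c i * (p i * (p i - 1) * ‖x - A i‖ ^ (-p i - 2)) := by
  have key : ∀ e : E3, 0 ≤ ∑ i, c i * (p i * (p i + 2) * ‖x - A i‖ ^ (-p i - 4)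
      * inner ℝ (x - A i) e ^ 2 - p i * ‖x - A i‖ ^ (-p i - 2) * ‖e‖ ^ 2) := by
    intro e
    choose g' h₁ h₂ using fun i => exists_hasDerivAt_norm_rpow_line (hx i) e (p i)
    refine nonneg_of_isLocalMin_of_hasDerivAt (a := 0)
      (g := fun t : ℝ => ∑ i, c i * ‖x + t • e - A i‖ ^ (-p i))
      (g' := fun t => ∑ i, c i * g' i t) ?_ ?_ ?_
    · filter_upwards [eventually_all.2 h₁] with t ht
      exact HasDerivAt.fun_sum fun i _ => (ht i).const_mul (c i)
    · exact HasDerivAt.fun_sum fun i _ => (h₂ i).const_mul (c i)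
    · have hc : ContinuousAt (fun t : ℝ => x + t • e) 0 := by fun_prop
      have ht : Tendsto (fun t : ℝ => x + t • e) (𝓝 0) (𝓝 x) := by simpa using hc.tendsto
      simpa [IsLocalMin, IsMinFilter] using ht.eventually hmin
  have hsum := Finset.sum_nonneg fun (j : Fin 3) (_ : j ∈ Finset.univ) =>
    key (EuclideanSpace.basisFun (Fin 3) ℝ j)
  rw [Finset.sum_comm] at hsum
  refine hsum.trans_eq (Finset.sum_congr rfl fun i _ => ?_)
  have hparseval : ∑ j, inner ℝ (x - A i) (EuclideanSpace.basisFun (Fin 3) ℝ j) ^ 2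
      = ‖x - A i‖ ^ 2 := by
    rw [EuclideanSpace.real_norm_sq_eq]
    simp [EuclideanSpace.inner_single_right]
  have hpos : 0 < ‖x - A i‖ := norm_pos_iff.2 (sub_ne_zero.2 (hx i))
  have hrpow : ‖x - A i‖ ^ (-p i - 2) = ‖x - A i‖ ^ (-p i - 4) * ‖x - A i‖ ^ 2 := by
    rw [← Real.rpow_natCast, ← Real.rpow_add hpos]
    congr 1; push_cast; ring
  simp only [OrthonormalBasis.norm_eq_one]
  rw [← Finset.mul_sum, Finset.sum_sub_distrib, ← Finset.mul_sum, hparseval, hrpow,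
    Finset.sum_const, Finset.card_univ, Fintype.card_fin, nsmul_eq_mul]
  push_cast
  ring

lemma continuousAt_norm_sub_rpow {x a : E3} (hx : x ≠ a) (r : ℝ) :
    ContinuousAt (fun y => ‖y - a‖ ^ r) x :=
  (continuousAt_id.sub continuousAt_const).norm.rpow_const
    (Or.inl (norm_ne_zero_iff.2 (sub_ne_zero.2 hx)))

lemma continuousAt_sum_norm_rpow {ι : Type*} [Fintype ι] {c p : ι → ℝ} {A : ι → E3} {x : E3}
    (hx : ∀ i, x ≠ A i) : ContinuousAt (fun y => ∑ i, c i * ‖y - A i‖ ^ (-p i)) x :=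
  tendsto_finsetSum _ fun i _ =>
    continuousAt_const.mul (continuousAt_norm_sub_rpow (hx i) (-p i))

/-- Strong minimum principle for Newtonian potentials, proved with the touching ball argument and
the subharmonic barrier `‖y - a‖ ^ (-2)`. -/
lemma eventually_eq_of_isLocalMin {ι : Type*} [Fintype ι] {c : ι → ℝ} {A : ι → E3} {x : E3}
    (hx : ∀ i, x ≠ A i) (hmin : IsLocalMin (fun y => ∑ i, c i * ‖y - A i‖ ^ (-1 : ℝ)) x) :
    ∀ᶠ y in 𝓝 x, ∑ i, c i * ‖y - A i‖ ^ (-1 : ℝ) = ∑ i, c i * ‖x - A i‖ ^ (-1 : ℝ) := by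
  set W : E3 → ℝ := fun y => ∑ i, c i * ‖y - A i‖ ^ (-1 : ℝ) with hW
  change ∀ᶠ y in 𝓝 x, W y = W x
  obtain ⟨R, hR, hball⟩ := Metric.eventually_nhds_iff_ball.1
    (hmin.and (eventually_all.2 fun i => isOpen_ne.eventually_mem (hx i)))
  have hcont : ∀ y ∈ ball x R, ContinuousAt W y := fun y hy =>
    continuousAt_sum_norm_rpow (p := fun _ => 1) (hball y hy).2
  have hsub : closedBall x (R / 2) ⊆ ball x R := closedBall_subset_ball (by linarith)
  by_contra hne
  obtain ⟨y, hyR, hy⟩ : ∃ y ∈ ball x (R / 4), W y ≠ W x := by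
    by_contra! h
    exact hne (Metric.eventually_nhds_iff_ball.2 ⟨R / 4, by linarith, h⟩)
  -- `z` is a point of the contact set nearest to `y`
  have hZ : IsCompact (closedBall x (R / 2) ∩ W ⁻¹' {W x}) := by
    refine (isCompact_closedBall x (R / 2)).of_isClosed_subset ?_ Set.inter_subset_left
    exact ContinuousOn.preimage_isClosed_of_isClosed
      (fun a ha => (hcont a (hsub ha)).continuousWithinAt) isClosed_closedBall isClosed_singleton
  obtain ⟨z, ⟨hzR, hzW⟩, hzmin⟩ := hZ.exists_isMinOn (f := fun a => dist a y)
    ⟨x, mem_closedBall_self (by linarith), rfl⟩ (by fun_prop)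
  replace hzW : W z = W x := hzW
  have hzx : dist z y ≤ dist x y :=
    hzmin (show x ∈ _ from ⟨mem_closedBall_self (by linarith), rfl⟩)
  have hzy : z ≠ y := fun h => hy (h ▸ hzW)
  have hzR' : dist z x < R / 2 := by
    have h₁ := dist_triangle z y x
    have h₂ : dist y x < R / 4 := hyR
    rw [dist_comm x y] at hzx
    linarith
  have hb : 0 < dist z y := dist_pos.2 hzy
  obtain ⟨s, hs, hsR, hsb⟩ : ∃ s, 0 < s ∧ s + dist z x < R / 2 ∧ s < dist z y / 2 :=
    ⟨min ((R / 2 - dist z x) / 2) (dist z y / 4), lt_min (by linarith) (by linarith),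
      by linarith [min_le_left ((R / 2 - dist z x) / 2) (dist z y / 4)],
      by linarith [min_le_right ((R / 2 - dist z x) / 2) (dist z y / 4)]⟩
  set y' : E3 := midpoint ℝ z y with hy'
  have hzy' : dist z y' = dist z y / 2 := by
    rw [hy', dist_left_midpoint]; norm_num; ring
  have hball_z : closedBall z s ⊆ closedBall x (R / 2) :=
    closedBall_subset_closedBall' hsR.le
  have hne' : ∀ a ∈ closedBall z s, a ≠ y' := by
    rintro a ha rfl
    rw [mem_closedBall, dist_comm, hzy'] at ha
    linarith
  set v : E3 → ℝ := fun a => ‖a - y'‖ ^ (-2 : ℝ) - ‖z - y'‖ ^ (-2 : ℝ) with hv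
  have hv_cont : ∀ a ∈ closedBall z s, ContinuousAt v a := fun a ha =>
    (continuousAt_norm_sub_rpow (hne' a ha) (-2)).sub continuousAt_const
  have hS : sphere z s ⊆ closedBall z s := sphere_subset_closedBall
  have hpos : ∀ a ∈ sphere z s, 0 ≤ v a → W x < W a := by
    intro a ha hva
    refine lt_of_le_of_ne (hball a (hsub (hball_z (hS ha)))).1 fun h => ?_
    have hd : dist z y ≤ dist a y := hzmin (show a ∈ _ from ⟨hball_z (hS ha), h.symm⟩)
    have haz : 0 < ‖a - z‖ := by rw [← dist_eq_norm, mem_sphere.1 ha]; exact hs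
    have hlt : ‖z - y'‖ < ‖a - y'‖ := by
      have e₁ : z - y' = (2⁻¹ : ℝ) • (z - y) := by rw [hy', left_sub_midpoint]; simp
      have e₂ : a - y' = (a - z) + (2⁻¹ : ℝ) • (z - y) := by rw [← e₁]; abel
      rw [dist_eq_norm, dist_eq_norm, show a - y = (a - z) + (z - y) by abel] at hd
      have hd2 := pow_le_pow_left₀ (norm_nonneg _) hd 2
      rw [norm_add_sq_real] at hd2
      refine lt_of_pow_lt_pow_left₀ 2 (norm_nonneg _) ?_
      rw [e₂, ← e₁, norm_add_sq_real, e₁, inner_smul_right]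
      nlinarith [pow_pos haz 2]
    have hzpos : 0 < ‖z - y'‖ := by rw [← dist_eq_norm, hzy']; linarith
    have := Real.rpow_lt_rpow_of_neg hzpos hlt (show (-2 : ℝ) < 0 by norm_num)
    simp only [hv] at hva
    linarith
  have hv_on : ContinuousOn v (sphere z s) := fun a ha => (hv_cont a (hS ha)).continuousWithinAt
  have hK : IsCompact (sphere z s ∩ v ⁻¹' Set.Ici 0) :=
    (isCompact_sphere z s).of_isClosed_subset
      (hv_on.preimage_isClosed_of_isClosed isClosed_sphere isClosed_Ici) Set.inter_subset_left
  obtain ⟨μ, hμ, hμK⟩ := hK.exists_forall_le' (f := W) (a := W x)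
    (fun a ha => (hcont a (hsub (hball_z (hS ha.1)))).continuousWithinAt)
    (fun a ha => hpos a ha.1 ha.2)
  obtain ⟨M, hM⟩ := (isCompact_sphere z s).bddAbove_image hv_on
  obtain ⟨ε, hε, hεM⟩ : ∃ ε > 0, ε * M < μ - W x := by
    refine ⟨(μ - W x) / (2 * (|M| + 1)), div_pos (by linarith) (by positivity), ?_⟩
    rw [div_mul_eq_mul_div, div_lt_iff₀ (by positivity)]
    nlinarith [le_abs_self M, abs_nonneg M]
  set w : E3 → ℝ := fun a => W a - ε * ‖a - y'‖ ^ (-2 : ℝ) with hw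
  have hw_sphere : ∀ a ∈ closedBall z s \ ball z s, w z < w a := by
    intro a ha
    rw [closedBall_sdiff_ball] at ha
    have hle : W x ≤ W a := (hball a (hsub (hball_z (hS ha)))).1
    suffices ε * v a < W a - W x by
      simp only [hw, hv, hzW] at this ⊢
      linarith
    rcases lt_or_ge (v a) 0 with h | h
    · nlinarith
    · have h₁ := hμK a ⟨ha, h⟩
      have h₂ := hM (Set.mem_image_of_mem v ha)
      nlinarith
  have hw_cont : ContinuousOn w (closedBall z s) := by
    intro a ha
    have h₁ := hcont a (hsub (hball_z ha))
    have h₂ := continuousAt_norm_sub_rpow (hne' a ha) (-2)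
    exact (h₁.sub (continuousAt_const.mul h₂)).continuousWithinAt
  obtain ⟨a, ha, hamin⟩ := (isCompact_closedBall z s).exists_isLocalMin_mem_open
    ball_subset_closedBall hw_cont (mem_closedBall_self hs.le) hw_sphere isOpen_ball
  have ha' := ball_subset_closedBall ha
  have hlap := laplacian_nonneg_of_isLocalMin (ι := Option ι) (x := a)
    (c := fun o => o.elim (-ε) c) (p := fun o => o.elim 2 fun _ => 1)
    (A := fun o => o.elim y' A)
    (by rintro (_ | i); exacts [hne' a ha', (hball a (hsub (hball_z ha'))).2 i])
    (by
      refine hamin.congr (.of_forall fun b => ?_)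
      simp [hw, hW, Fintype.sum_option]
      ring)
  have hapos : 0 < ‖a - y'‖ := norm_pos_iff.2 (sub_ne_zero.2 (hne' a ha'))
  have := Real.rpow_pos_of_pos hapos (-2 - 2)
  simp at hlap
  nlinarith

/-- A Newtonian potential with nonzero charges is not locally constant: continue it analytically
along the segment to the nearest charge, where it blows up. -/
lemma not_eventually_eq_const {n : ℕ} (hn : 0 < n) {A : Fin n → E3} (hA : Function.Injective A)
    {c : Fin n → ℝ} (hc : ∀ i, c i ≠ 0) {x : E3} (hx : ∀ i, x ≠ A i) (m : ℝ) :
    ¬ ∀ᶠ y in 𝓝 x, ∑ i, c i * ‖y - A i‖ ^ (-1 : ℝ) = m := by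
  intro hconst
  have : Nonempty (Fin n) := ⟨⟨0, hn⟩⟩
  obtain ⟨j, hj⟩ := Finite.exists_min fun i => ‖A i - x‖
  have hjpos : 0 < ‖A j - x‖ := norm_pos_iff.2 (sub_ne_zero.2 (hx j).symm)
  set ℓ : ℝ → E3 := fun t => x + t • (A j - x) with hℓ
  have hℓj : ∀ t, ℓ t - A j = (1 - t) • (x - A j) := fun t => by
    simp only [hℓ]; module
  have hne : ∀ t ∈ Set.Ico (0 : ℝ) 1, ∀ i, ℓ t ≠ A i := by
    intro t ht i h
    have h₁ : ‖A i - x‖ = t * ‖A j - x‖ := by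
      rw [← h, hℓ, add_sub_cancel_left, norm_smul, Real.norm_eq_abs, abs_of_nonneg ht.1]
    have h₂ := hj i
    nlinarith [ht.2]
  set h : ℝ → ℝ := fun t => ∑ i, c i * ‖ℓ t - A i‖⁻¹ with hh
  have han : AnalyticOnNhd ℝ h (Set.Ico 0 1) := by
    intro t ht
    refine Finset.analyticAt_fun_sum _ fun i _ => analyticAt_const.mul ?_
    have hi : ℓ t - A i ≠ 0 := sub_ne_zero.2 (hne t ht i)
    have h₁ : ContDiffAt ℝ ⊤ (fun t => ‖ℓ t - A i‖) t :=
      ContDiffAt.norm ℝ (by simp only [hℓ]; fun_prop) hi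
    exact h₁.analyticAt.inv (norm_ne_zero_iff.2 hi)
  have hℓ0 : Tendsto ℓ (𝓝 0) (𝓝 x) := by
    have : ContinuousAt ℓ 0 := by simp only [hℓ]; fun_prop
    simpa [hℓ] using this.tendsto
  have heq : Set.EqOn h (fun _ => m) (Set.Ico 0 1) := by
    refine han.eqOn_of_preconnected_of_eventuallyEq analyticOnNhd_const isPreconnected_Ico
      (Set.left_mem_Ico.2 one_pos) ?_
    filter_upwards [hℓ0.eventually hconst] with t ht
    simpa [hh, Real.rpow_neg_one] using ht
  have hlim₁ : Tendsto (fun t => (1 - t) * h t) (𝓝[<] (1 : ℝ)) (𝓝 0) := by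
    have : Tendsto (fun t : ℝ => (1 - t) * m) (𝓝[<] (1 : ℝ)) (𝓝 0) := by
      have hcont : ContinuousAt (fun t : ℝ => (1 - t) * m) 1 := by fun_prop
      simpa using hcont.tendsto.mono_left nhdsWithin_le_nhds
    refine this.congr' ?_
    filter_upwards [Ico_mem_nhdsLT (zero_lt_one' ℝ)] with t ht
    rw [heq ht]
  have hlim₂ : Tendsto (fun t => (1 - t) * h t) (𝓝[<] (1 : ℝ))
      (𝓝 (∑ i, if i = j then c j * ‖x - A j‖⁻¹ else 0)) := by
    simp only [hh, Finset.mul_sum]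
    refine tendsto_finsetSum _ fun i _ => ?_
    split_ifs with hij
    · subst hij
      refine tendsto_const_nhds.congr' ?_
      filter_upwards [self_mem_nhdsWithin] with t ht
      have ht : 0 < 1 - t := sub_pos.2 ht
      rw [hℓj, norm_smul, Real.norm_eq_abs, abs_of_pos ht, mul_inv]
      field_simp
    · have hi : ‖ℓ 1 - A i‖ ≠ 0 := by
        have : ℓ 1 = A j := by simp [hℓ]
        rw [this]
        exact norm_ne_zero_iff.2 (sub_ne_zero.2 fun h => hij (hA h).symm)
      have hcont : ContinuousAt (fun t => (1 - t) * (c i * ‖ℓ t - A i‖⁻¹)) 1 := by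
        have : ContinuousAt (fun t => ‖ℓ t - A i‖⁻¹) 1 :=
          ContinuousAt.inv₀ (by simp only [hℓ]; fun_prop) hi
        exact ContinuousAt.mul (by fun_prop) (continuousAt_const.mul this)
      simpa using hcont.tendsto.mono_left nhdsWithin_le_nhds
  have h0 := tendsto_nhds_unique hlim₁ hlim₂
  rw [Finset.sum_ite_eq' Finset.univ j, if_pos (Finset.mem_univ j)] at h0
  exact mul_ne_zero (hc j) (inv_ne_zero (norm_ne_zero_iff.2 (sub_ne_zero.2 (hx j)))) h0.symm

lemma not_isLocalMin_newtonian {n : ℕ} (hn : 0 < n) {A : Fin n → E3} (hA : Function.Injective A)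
    {c : Fin n → ℝ} (hc : ∀ i, c i ≠ 0) {x : E3} (hx : ∀ i, x ≠ A i) :
    ¬ IsLocalMin (fun y => ∑ i, c i * ‖y - A i‖ ^ (-1 : ℝ)) x := fun h =>
  not_eventually_eq_const hn hA hc hx _ (eventually_eq_of_isLocalMin hx h)

lemma Vp_eq {n : ℕ} (A : Fin n → E3) (ζ : Fin n → ℝ) (p : ℝ) :
    Vp A ζ p = fun y => ∑ i, ζ i ^ p * ‖y - A i‖ ^ (-p) := by
  funext y
  exact Finset.sum_congr rfl fun i _ => by rw [Real.rpow_neg (norm_nonneg _), div_eq_mul_inv]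

lemma compl_points_mem_nhds {n : ℕ} {A : Fin n → E3} {x : E3} (hx : ∀ i, x ≠ A i) :
    {y : E3 | ∀ i, y ≠ A i} ∈ 𝓝 x :=
  eventually_all.2 fun i => isOpen_ne.eventually_mem (hx i)

/-- for positive charges and `0 < p < 1`, `V_p` has no local minimum
on its domain; moreover `V_1` has neither local minima nor local maxima there. -/
theorem stmt16 (n : ℕ) (hn : 0 < n) (A : Fin n → E3) (hA : Function.Injective A)
    (ζ : Fin n → ℝ) :
    (∀ i, 0 < ζ i) →
    (∀ p : ℝ, 0 < p → p < 1 → ∀ x : E3, (∀ i, x ≠ A i) →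
      ¬ IsLocalMinOn (Vp A ζ p) {y : E3 | ∀ i, y ≠ A i} x) ∧
    (∀ x : E3, (∀ i, x ≠ A i) →
      ¬ IsLocalMinOn (Vp A ζ 1) {y : E3 | ∀ i, y ≠ A i} x ∧
      ¬ IsLocalMaxOn (Vp A ζ 1) {y : E3 | ∀ i, y ≠ A i} x) := by
  intro hζ
  refine ⟨fun p hp hp1 x hx hmin => ?_, fun x hx => ⟨fun hmin => ?_, fun hmax => ?_⟩⟩
  · have h := hmin.isLocalMin (compl_points_mem_nhds hx)
    rw [Vp_eq] at h
    refine (laplacian_nonneg_of_isLocalMin (p := fun _ => p) hx h).not_gt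
      (Finset.sum_neg (fun i _ => ?_) ⟨⟨0, hn⟩, Finset.mem_univ _⟩)
    have hpos : 0 < ‖x - A i‖ := norm_pos_iff.2 (sub_ne_zero.2 (hx i))
    exact mul_neg_of_pos_of_neg (Real.rpow_pos_of_pos (hζ i) p)
      (mul_neg_of_neg_of_pos (mul_neg_of_pos_of_neg hp (by linarith))
        (Real.rpow_pos_of_pos hpos _))
  · have h := hmin.isLocalMin (compl_points_mem_nhds hx)
    rw [Vp_eq] at h
    exact not_isLocalMin_newtonian hn hA (fun i => (Real.rpow_pos_of_pos (hζ i) 1).ne') hx h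
  · have h := (hmax.isLocalMax (compl_points_mem_nhds hx)).neg
    rw [Vp_eq] at h
    refine not_isLocalMin_newtonian hn hA (c := fun i => -ζ i ^ (1 : ℝ))
      (fun i => neg_ne_zero.2 (Real.rpow_pos_of_pos (hζ i) 1).ne') hx ?_
    simpa only [neg_mul, Finset.sum_neg_distrib] using h
end
end

section
/- Let V be the electrostatic potential of eight unit point charges at the vertices of the square anti-prism with circumradius R = 1 and height h = √2, namely at A_ℓ = (cos(ℓπ/2 + π/8), sin(ℓπ/2 + π/8), √2/2) and B_ℓ = (cos(ℓπ/2 + π/8), −sin(ℓπ/2 + π/8), −√2/2) for ℓ = 1, 2, 3, 4. Then V(0) = 8√6/3, all partial derivatives of V at the origin of orders 1, 2, and 3 vanish, and the fourth-order Taylor expansion of V at the origin is V(x_1,x_2,x_3) = (8√6/3)·(1 − (7/108)(x_1⁴ + x_2⁴) − (14/81)x_3⁴ − (7/54)x_1²x_2² + (14/27)x_3²(x_1² + x_2²)) + o(‖x‖⁴) as x → 0. -/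
noncomputable section

open Finset Topology Asymptotics

/-- The point `(a, b, c)` of `ℝ³`. -/
def pt (a b c : ℝ) : E3 := (WithLp.equiv 2 (Fin 3 → ℝ)).symm ![a, b, c]

/-- The top vertices of the square anti-prism with circumradius `1` and height `√2`:
`A_ℓ = (cos(ℓπ/2 + π/8), sin(ℓπ/2 + π/8), √2/2)`. -/
def Asq (ℓ : Fin 4) : E3 :=
  pt (Real.cos ((ℓ : ℕ) * (Real.pi / 2) + Real.pi / 8))
    (Real.sin ((ℓ : ℕ) * (Real.pi / 2) + Real.pi / 8)) (Real.sqrt 2 / 2)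

/-- The bottom vertices of the square anti-prism:
`B_ℓ = (cos(ℓπ/2 + π/8), -sin(ℓπ/2 + π/8), -√2/2)`. -/
def Bsq (ℓ : Fin 4) : E3 :=
  pt (Real.cos ((ℓ : ℕ) * (Real.pi / 2) + Real.pi / 8))
    (-Real.sin ((ℓ : ℕ) * (Real.pi / 2) + Real.pi / 8)) (-(Real.sqrt 2 / 2))

/-- The electrostatic potential of the eight unit point charges at the vertices of
the square anti-prism with `R = 1`, `h = √2`. -/
def Vsq : E3 → ℝ :=
  fun x => ∑ ℓ : Fin 4, (1 / ‖x - Asq ℓ‖ + 1 / ‖x - Bsq ℓ‖)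

/-- Polarization: the symmetrization of a multilinear map is an alternating sum of values on the
diagonal. -/
theorem MultilinearMap.sum_perm_eq_sum_diagonal {R M N : Type*} [CommRing R] [AddCommGroup M]
    [Module R M] [AddCommGroup N] [Module R N] {n : ℕ}
    (q : MultilinearMap R (fun _ : Fin n => M) N) (v : Fin n → M) :
    ∑ σ : Equiv.Perm (Fin n), q (fun i => v (σ i)) =
      ∑ t : Finset (Fin n), (-1 : ℤ) ^ #t • q (fun _ => ∑ j ∈ tᶜ, v j) := by
  have hexp (t : Finset (Fin n)) : q (fun _ => ∑ j ∈ tᶜ, v j) =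
      ∑ r : Fin n → Fin n,
        if t ⊆ (univ.image r)ᶜ then q (fun i => v (r i)) else 0 := by
    rw [q.map_sum_finset (fun _ j => v j) (fun _ => tᶜ), ← Finset.sum_filter]
    refine Finset.sum_congr ?_ fun _ _ => rfl
    ext r
    simp only [Fintype.mem_piFinset, mem_compl, mem_filter, mem_univ, true_and, subset_iff,
      mem_image, not_exists]
    exact ⟨fun h j hj i hi => h i (hi ▸ hj), fun h i hi => h hi i rfl⟩
  have hcoef (r : Fin n → Fin n) :
      ∑ t : Finset (Fin n), (-1 : ℤ) ^ #t •
        (if t ⊆ (univ.image r)ᶜ then q (fun i => v (r i)) else 0) =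
      if Function.Bijective r then q (fun i => v (r i)) else 0 := by
    simp only [smul_ite, smul_zero]
    rw [← Finset.sum_filter, ← Finset.sum_smul]
    have hp : univ.filter (fun t => t ⊆ (univ.image r)ᶜ) = ((univ.image r)ᶜ).powerset := by
      ext t
      simp
    have hb : (univ.image r)ᶜ = ∅ ↔ Function.Bijective r := by
      rw [compl_eq_empty_iff, ← Finset.coe_eq_univ, coe_image, coe_univ, Set.image_univ,
        Set.range_eq_univ, Finite.surjective_iff_bijective]
    rw [hp, sum_powerset_neg_one_pow_card]
    simp only [hb, ite_smul, one_smul, zero_smul]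
  simp_rw [hexp, Finset.smul_sum]
  rw [Finset.sum_comm]
  simp_rw [hcoef]
  rw [← Finset.sum_filter]
  refine Finset.sum_bij (fun σ _ => ⇑σ) (fun σ _ => ?_) (fun σ _ τ _ h => ?_) (fun r hr => ?_)
    fun _ _ => rfl
  · exact mem_filter.2 ⟨mem_univ _, σ.bijective⟩
  · exact DFunLike.coe_injective h
  · exact ⟨Equiv.ofBijective r (mem_filter.1 hr).2, mem_univ _, rfl⟩

/-- The homogeneous parts of degree at most `n` of an analytic function that is `O(‖y‖ ^ (n + 1))`
vanish on the diagonal. -/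
theorem HasFPowerSeriesAt.apply_diagonal_eq_zero {𝕜 E F : Type*} [NontriviallyNormedField 𝕜]
    [NormedAddCommGroup E] [NormedSpace 𝕜 E] [NormedAddCommGroup F] [NormedSpace 𝕜 F]
    {f : E → F} {p : FormalMultilinearSeries 𝕜 E F} {n : ℕ} (h : HasFPowerSeriesAt f p 0)
    (hf : f =O[𝓝 0] fun y => ‖y‖ ^ (n + 1)) (k : ℕ) (hk : k ≤ n) (y : E) :
    (p k fun _ => y) = 0 := by
  induction k using Nat.strong_induction_on generalizing y with
  | _ k ih =>
    have hsum : p.partialSum (k + 1) = fun y => p k fun _ => y := by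
      funext z
      refine Finset.sum_eq_single _ (fun b hb hne => ?_) fun hn => by simp at hn
      have hb' : b < k := by have := Finset.mem_range.mp hb; omega
      exact ih b hb' (by omega) z
    have h1 := h.isBigO_sub_partialSum_pow (k + 1)
    simp only [hsum, zero_add] at h1
    have h2 : f =O[𝓝 0] fun y => ‖y‖ ^ (k + 1) := by
      refine hf.trans ?_
      refine IsBigO.of_bound 1 ?_
      filter_upwards [Metric.ball_mem_nhds (0 : E) one_pos] with z hz
      rw [mem_ball_zero_iff] at hz
      simpa using pow_le_pow_of_le_one (norm_nonneg z) hz.le (by omega : k + 1 ≤ n + 1)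
    have h3 : (fun y => p k fun _ => y) =O[𝓝 0] fun y => ‖y‖ ^ (k + 1) := by
      simpa using h2.sub h1
    exact h3.continuousMultilinearMap_apply_eq_zero y

/-- An analytic function that is `O(‖y‖ ^ (n + 1))` at the origin has vanishing iterated derivatives
of order at most `n` there. -/
theorem AnalyticAt.iteratedFDeriv_eq_zero_of_isBigO {𝕜 E F : Type*} [NontriviallyNormedField 𝕜]
    [NormedAddCommGroup E] [NormedSpace 𝕜 E] [NormedAddCommGroup F] [NormedSpace 𝕜 F]
    [CompleteSpace F] {f : E → F} {n : ℕ} (h : AnalyticAt 𝕜 f 0)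
    (hf : f =O[𝓝 0] fun y => ‖y‖ ^ (n + 1)) {k : ℕ} (hk : k ≤ n) :
    iteratedFDeriv 𝕜 k f 0 = 0 := by
  obtain ⟨p, r, hp⟩ := h
  ext v
  rw [hp.iteratedFDeriv_eq_sum_of_completeSpace]
  refine ((p k).toMultilinearMap.sum_perm_eq_sum_diagonal v).trans ?_
  refine Finset.sum_eq_zero fun t _ => ?_
  have := hp.hasFPowerSeriesAt.apply_diagonal_eq_zero hf k hk (∑ j ∈ tᶜ, v j)
  exact (congrArg _ this).trans (smul_zero _)

/-- The generating function of the Legendre polynomials, to fourth order. -/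
theorem exists_legendre_generating_bound :
    ∃ C : ℝ, ∀ r m : ℝ, 0 ≤ r → r ≤ 1 / 10 → |m| ≤ 1 →
      |1 / √(1 - 2 * (r * m) + r ^ 2) -
        (1 + r * m + (3 * (r * m) ^ 2 - r ^ 2) / 2 +
          (5 * (r * m) ^ 3 - 3 * (r * m) * r ^ 2) / 2 +
          (35 * (r * m) ^ 4 - 30 * (r * m) ^ 2 * r ^ 2 + 3 * (r ^ 2) ^ 2) / 8)| ≤ C * r ^ 5 := by
  set P : ℝ × ℝ → ℝ := fun z =>
    ((-240 * z.2 + 1120 * z.2 ^ 3 - 1008 * z.2 ^ 5) +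
      z.1 * (40 - 600 * z.2 ^ 2 + 1400 * z.2 ^ 4 - 840 * z.2 ^ 6) +
      z.1 ^ 2 * (120 * z.2 - 1000 * z.2 ^ 3 + 1960 * z.2 ^ 5 - 1080 * z.2 ^ 7) +
      z.1 ^ 3 * (-15 + 420 * z.2 ^ 2 - 2050 * z.2 ^ 4 + 3220 * z.2 ^ 6 - 1575 * z.2 ^ 8) +
      z.1 ^ 4 * (-90 * z.2 + 1200 * z.2 ^ 3 - 4260 * z.2 ^ 5 + 5600 * z.2 ^ 7 - 2450 * z.2 ^ 9) +
      z.1 ^ 5 * (9 - 180 * z.2 ^ 2 + 1110 * z.2 ^ 4 - 2100 * z.2 ^ 6 + 1225 * z.2 ^ 8)) / 64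
    with hP
  obtain ⟨C, hC⟩ := (isCompact_Icc (a := ((0 : ℝ), (-1 : ℝ))) (b := ((1 : ℝ), (1 : ℝ)))
    ).exists_bound_of_continuousOn (f := P) (by fun_prop)
  refine ⟨2 * C, fun r m hr0 hr1 hm => ?_⟩
  obtain ⟨hm0, hm1⟩ := abs_le.mp hm
  have hPC : |P (r, m)| ≤ C := hC (r, m) ⟨⟨hr0, hm0⟩, ⟨by simpa using by linarith, hm1⟩⟩
  have ht : |r * m| ≤ 1 / 10 := by
    rw [abs_mul, abs_of_nonneg hr0]
    nlinarith [abs_nonneg m]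
  have hr2 : r ^ 2 ≤ 1 / 100 := by nlinarith
  have hW : (1 + r * m + (3 * (r * m) ^ 2 - r ^ 2) / 2 +
      (5 * (r * m) ^ 3 - 3 * (r * m) * r ^ 2) / 2 +
      (35 * (r * m) ^ 4 - 30 * (r * m) ^ 2 * r ^ 2 + 3 * (r ^ 2) ^ 2) / 8) ^ 2 *
      (1 - 2 * (r * m) + r ^ 2) - 1 = r ^ 5 * P (r, m) := by
    rw [hP]
    ring
  have hs0 := sq_nonneg r
  generalize r * m = t at *
  generalize r ^ 2 = s at *
  generalize P (r, m) = p at *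
  clear_value P
  obtain ⟨ht0, ht1⟩ := abs_le.mp ht
  have hS4 : 1 / 4 ≤ 1 - 2 * t + s := by linarith
  have hL0 : 0 ≤ 1 + t + (3 * t ^ 2 - s) / 2 + (5 * t ^ 3 - 3 * t * s) / 2 +
      (35 * t ^ 4 - 30 * t ^ 2 * s + 3 * s ^ 2) / 8 := by
    have ht2 : t ^ 2 ≤ 1 / 100 := by nlinarith
    have h3 : -(1 / 1000) ≤ t ^ 3 := by nlinarith [sq_nonneg t]
    have h3' : t * s ≤ 1 / 1000 := by nlinarith
    have h4 : t ^ 2 * s ≤ 1 / 10000 := by nlinarith [sq_nonneg t]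
    have h5 : 0 ≤ t ^ 4 := by positivity
    linarith [sq_nonneg t, sq_nonneg s]
  generalize 1 + t + (3 * t ^ 2 - s) / 2 + (5 * t ^ 3 - 3 * t * s) / 2 +
      (35 * t ^ 4 - 30 * t ^ 2 * s + 3 * s ^ 2) / 8 = L at *
  generalize 1 - 2 * t + s = S at *
  have hSpos : 0 < S := by linarith
  set y := 1 / √S with hy
  have hypos : 0 < y := by positivity
  have hyS : y ^ 2 * S = 1 := by
    rw [hy, div_pow, Real.sq_sqrt hSpos.le]
    field_simp
  have hy2 : y ≤ 2 := by nlinarith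
  have hfac : (y - L) * (y + L) = -(y ^ 2 * (r ^ 5 * p)) := by
    rw [← hW]
    linear_combination L ^ 2 * hyS
  have habs : |y - L| * (y + L) = y ^ 2 * (r ^ 5 * |p|) := by
    rw [← abs_of_nonneg (by positivity : 0 ≤ y + L), ← abs_mul, hfac, abs_neg, abs_mul, abs_mul,
      abs_of_nonneg (by positivity : 0 ≤ y ^ 2), abs_of_nonneg (by positivity : 0 ≤ r ^ 5)]
  have hle : |y - L| * y ≤ (y * (r ^ 5 * C)) * y := by
    calc |y - L| * y ≤ |y - L| * (y + L) := by gcongr; linarith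
      _ = y ^ 2 * (r ^ 5 * |p|) := habs
      _ ≤ y ^ 2 * (r ^ 5 * C) := by gcongr
      _ = _ := by ring
  have hC0 : 0 ≤ C := (abs_nonneg _).trans hPC
  calc |y - L| ≤ y * (r ^ 5 * C) := le_of_mul_le_mul_right hle hypos
    _ ≤ 2 * (r ^ 5 * C) := by gcongr
    _ = 2 * C * r ^ 5 := by ring

/-- The multipole expansion of the Coulomb potential of a charge at `a`, to fourth order. -/
theorem isBigO_one_div_norm_sub {E : Type*} [NormedAddCommGroup E] [InnerProductSpace ℝ E]
    {a : E} (ha : a ≠ 0) :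
    (fun x : E => 1 / ‖x - a‖ - 1 / ‖a‖ *
      (1 + inner ℝ x a / ‖a‖ ^ 2 +
        (3 * (inner ℝ x a / ‖a‖ ^ 2) ^ 2 - ‖x‖ ^ 2 / ‖a‖ ^ 2) / 2 +
        (5 * (inner ℝ x a / ‖a‖ ^ 2) ^ 3 -
          3 * (inner ℝ x a / ‖a‖ ^ 2) * (‖x‖ ^ 2 / ‖a‖ ^ 2)) / 2 +
        (35 * (inner ℝ x a / ‖a‖ ^ 2) ^ 4 -
          30 * (inner ℝ x a / ‖a‖ ^ 2) ^ 2 * (‖x‖ ^ 2 / ‖a‖ ^ 2) +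
          3 * (‖x‖ ^ 2 / ‖a‖ ^ 2) ^ 2) / 8)) =O[𝓝 0] fun x => ‖x‖ ^ 5 := by
  obtain ⟨C, hC⟩ := exists_legendre_generating_bound
  have hD : 0 < ‖a‖ := norm_pos_iff.mpr ha
  refine IsBigO.of_bound (1 / ‖a‖ * (C / ‖a‖ ^ 5)) ?_
  filter_upwards [Metric.ball_mem_nhds (0 : E) (by positivity : 0 < ‖a‖ / 10)] with x hx
  rw [mem_ball_zero_iff] at hx
  obtain ⟨m, hm, hxm⟩ : ∃ m : ℝ, |m| ≤ 1 ∧ inner ℝ x a / ‖a‖ ^ 2 = ‖x‖ / ‖a‖ * m := by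
    refine ⟨inner ℝ x a / (‖x‖ * ‖a‖), abs_real_inner_div_norm_mul_norm_le_one x a, ?_⟩
    rcases eq_or_ne x 0 with rfl | hx0
    · simp
    · have := norm_pos_iff.mpr hx0
      field_simp
  have hnorm : ‖x - a‖ = ‖a‖ * √(1 - 2 * (‖x‖ / ‖a‖ * m) + (‖x‖ / ‖a‖) ^ 2) := by
    rw [← hxm, ← Real.sqrt_sq (norm_nonneg (x - a)), norm_sub_sq_real,
      ← Real.sqrt_sq hD.le, ← Real.sqrt_mul (sq_nonneg _), Real.sqrt_sq hD.le]
    congr 1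
    field_simp
    ring
  have hb := hC (‖x‖ / ‖a‖) m (by positivity) (by rw [div_le_iff₀ hD]; linarith) hm
  rw [hnorm, hxm, ← div_pow, ← one_div_mul_one_div, ← mul_sub, norm_mul,
    Real.norm_of_nonneg (by positivity : 0 ≤ 1 / ‖a‖), Real.norm_eq_abs,
    Real.norm_of_nonneg (by positivity : 0 ≤ ‖x‖ ^ 5)]
  calc _ ≤ 1 / ‖a‖ * (C * (‖x‖ / ‖a‖) ^ 5) := by gcongr
    _ = _ := by ring

/-- The fourth-order multipole polynomials of the eight vertices add up to the Taylor polynomial of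
the potential. -/
theorem sum_legendre_antiprism {x y z c s w : ℝ} (hcs : c ^ 2 + s ^ 2 = 1)
    (hcs' : c ^ 2 * s ^ 2 = 1 / 8) (hw : w ^ 2 = 1 / 2) {T : ℝ → ℝ}
    (hT : ∀ l, T l = 1 + l / (3 / 2) +
      (3 * (l / (3 / 2)) ^ 2 - (x ^ 2 + y ^ 2 + z ^ 2) / (3 / 2)) / 2 +
      (5 * (l / (3 / 2)) ^ 3 - 3 * (l / (3 / 2)) * ((x ^ 2 + y ^ 2 + z ^ 2) / (3 / 2))) / 2 +
      (35 * (l / (3 / 2)) ^ 4 - 30 * (l / (3 / 2)) ^ 2 * ((x ^ 2 + y ^ 2 + z ^ 2) / (3 / 2)) +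
        3 * ((x ^ 2 + y ^ 2 + z ^ 2) / (3 / 2)) ^ 2) / 8) :
    (T (x * c + y * s + z * w) + T (x * c + y * -s + z * -w)) +
    (T (x * -s + y * c + z * w) + T (x * -s + y * -c + z * -w)) +
    (T (x * -c + y * -s + z * w) + T (x * -c + y * s + z * -w)) +
    (T (x * s + y * -c + z * w) + T (x * s + y * c + z * -w)) =
    8 * (1 - (7 / 108) * (x ^ 4 + y ^ 4) - (14 / 81) * z ^ 4 - (7 / 54) * x ^ 2 * y ^ 2 +
      (14 / 27) * z ^ 2 * (x ^ 2 + y ^ 2)) := by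
  have h2 : ((x * c + y * s + z * w) ^ 2 + (x * c + y * -s + z * -w) ^ 2) +
      ((x * -s + y * c + z * w) ^ 2 + (x * -s + y * -c + z * -w) ^ 2) +
      ((x * -c + y * -s + z * w) ^ 2 + (x * -c + y * s + z * -w) ^ 2) +
      ((x * s + y * -c + z * w) ^ 2 + (x * s + y * c + z * -w) ^ 2) =
      4 * (x ^ 2 + y ^ 2 + z ^ 2) := by
    linear_combination 4 * (x ^ 2 + y ^ 2) * hcs + 8 * z ^ 2 * hw
  have h3 : ((x * c + y * s + z * w) ^ 3 + (x * c + y * -s + z * -w) ^ 3) +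
      ((x * -s + y * c + z * w) ^ 3 + (x * -s + y * -c + z * -w) ^ 3) +
      ((x * -c + y * -s + z * w) ^ 3 + (x * -c + y * s + z * -w) ^ 3) +
      ((x * s + y * -c + z * w) ^ 3 + (x * s + y * c + z * -w) ^ 3) = 0 := by
    ring
  have h4 : ((x * c + y * s + z * w) ^ 4 + (x * c + y * -s + z * -w) ^ 4) +
      ((x * -s + y * c + z * w) ^ 4 + (x * -s + y * -c + z * -w) ^ 4) +
      ((x * -c + y * -s + z * w) ^ 4 + (x * -c + y * s + z * -w) ^ 4) +
      ((x * s + y * -c + z * w) ^ 4 + (x * s + y * c + z * -w) ^ 4) =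
      3 * (x ^ 2 + y ^ 2) ^ 2 + 12 * z ^ 2 * (x ^ 2 + y ^ 2) + 2 * z ^ 4 := by
    linear_combination
      (4 * (x ^ 4 + y ^ 4) * (c ^ 2 + s ^ 2 + 1) + 24 * z ^ 2 * (x ^ 2 + y ^ 2) * w ^ 2) * hcs +
      (48 * x ^ 2 * y ^ 2 - 8 * (x ^ 4 + y ^ 4)) * hcs' +
      (24 * z ^ 2 * (x ^ 2 + y ^ 2) + 8 * z ^ 4 * (w ^ 2 + 1 / 2)) * hw
  simp only [hT]
  linear_combination (2 / 3 - 10 / 9 * (x ^ 2 + y ^ 2 + z ^ 2)) * h2 + 20 / 27 * h3 + 70 / 81 * h4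

theorem inner_pt (x : E3) (a b c : ℝ) : inner ℝ x (pt a b c) = x 0 * a + x 1 * b + x 2 * c := by
  simp [pt, PiLp.inner_apply, Fin.sum_univ_three, mul_comm]

theorem norm_sq_pt (a b c : ℝ) : ‖pt a b c‖ ^ 2 = a ^ 2 + b ^ 2 + c ^ 2 := by
  simp [pt, EuclideanSpace.norm_sq_eq, Fin.sum_univ_three]

theorem norm_Asq (ℓ : Fin 4) : ‖Asq ℓ‖ = √6 / 2 := by
  rw [← sq_eq_sq₀ (norm_nonneg _) (by positivity), Asq, norm_sq_pt, Real.cos_sq_add_sin_sq,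
    div_pow, div_pow, Real.sq_sqrt (by norm_num), Real.sq_sqrt (by norm_num)]
  norm_num

theorem norm_Bsq (ℓ : Fin 4) : ‖Bsq ℓ‖ = √6 / 2 := by
  rw [← norm_Asq ℓ, ← sq_eq_sq₀ (norm_nonneg _) (norm_nonneg _), Asq, Bsq, norm_sq_pt, norm_sq_pt,
    neg_sq, neg_sq]

theorem Asq_ne_zero (ℓ : Fin 4) : Asq ℓ ≠ 0 := by
  rw [← norm_pos_iff, norm_Asq]
  positivity

theorem Bsq_ne_zero (ℓ : Fin 4) : Bsq ℓ ≠ 0 := by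
  rw [← norm_pos_iff, norm_Bsq]
  positivity

theorem one_div_sqrt_six_div_two : 1 / (√6 / 2) = √6 / 3 := by
  have h : √6 ^ 2 = 6 := Real.sq_sqrt (by norm_num)
  field_simp
  linarith

theorem Vsq_zero : Vsq 0 = 8 * √6 / 3 := by
  simp only [Vsq, zero_sub, norm_neg, norm_Asq, norm_Bsq, one_div_sqrt_six_div_two, sum_const,
    card_univ, Fintype.card_fin, nsmul_eq_mul]
  push_cast
  ring

theorem analyticAt_Vsq : AnalyticAt ℝ Vsq 0 := by
  have h {a : E3} (ha : a ≠ 0) : AnalyticAt ℝ (fun x => 1 / ‖x - a‖) 0 := by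
    refine ContDiffAt.analyticAt ?_
    have ha' : (0 : E3) - a ≠ 0 := by simpa using ha
    exact contDiffAt_const.div ((contDiffAt_id.sub contDiffAt_const).norm ℝ ha')
      (norm_ne_zero_iff.mpr ha')
  exact Finset.analyticAt_fun_sum _ fun ℓ _ => (h (Asq_ne_zero ℓ)).add (h (Bsq_ne_zero ℓ))

theorem Vsq_sub_taylor_isBigO :
    (fun x : E3 => Vsq x -
        (8 * √6 / 3) *
          (1 - (7 / 108) * ((x 0) ^ 4 + (x 1) ^ 4) - (14 / 81) * (x 2) ^ 4 -
            (7 / 54) * (x 0) ^ 2 * (x 1) ^ 2 +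
            (14 / 27) * (x 2) ^ 2 * ((x 0) ^ 2 + (x 1) ^ 2)))
      =O[𝓝 0] fun x : E3 => ‖x‖ ^ 5 := by
  have h := IsBigO.sum (s := (univ : Finset (Fin 4))) fun ℓ _ =>
    (isBigO_one_div_norm_sub (Asq_ne_zero ℓ)).add (isBigO_one_div_norm_sub (Bsq_ne_zero ℓ))
  refine h.congr_left fun x => ?_
  have hD : (√6 / 2) ^ 2 = 3 / 2 := by
    rw [div_pow, Real.sq_sqrt (by norm_num)]
    norm_num
  have hw : (√2 / 2) ^ 2 = 1 / 2 := by
    rw [div_pow, Real.sq_sqrt (by norm_num)]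
    norm_num
  have hcs : Real.cos (Real.pi / 8) ^ 2 + Real.sin (Real.pi / 8) ^ 2 = 1 :=
    Real.cos_sq_add_sin_sq _
  have hcs' : Real.cos (Real.pi / 8) ^ 2 * Real.sin (Real.pi / 8) ^ 2 = 1 / 8 := by
    have h1 := Real.sin_two_mul (Real.pi / 8)
    rw [show 2 * (Real.pi / 8) = Real.pi / 4 by ring, Real.sin_pi_div_four] at h1
    rw [h1] at hw
    linear_combination hw / 4
  have hx : ‖x‖ ^ 2 = x 0 ^ 2 + x 1 ^ 2 + x 2 ^ 2 := by
    simp [EuclideanSpace.norm_sq_eq, Fin.sum_univ_three]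
  have c1 : Real.cos (Real.pi / 2 + Real.pi / 8) = -Real.sin (Real.pi / 8) := by
    rw [add_comm, Real.cos_add_pi_div_two]
  have s1 : Real.sin (Real.pi / 2 + Real.pi / 8) = Real.cos (Real.pi / 8) := by
    rw [add_comm, Real.sin_add_pi_div_two]
  have c2 : Real.cos (2 * (Real.pi / 2) + Real.pi / 8) = -Real.cos (Real.pi / 8) := by
    rw [← Real.cos_add_pi]
    ring_nf
  have s2 : Real.sin (2 * (Real.pi / 2) + Real.pi / 8) = -Real.sin (Real.pi / 8) := by
    rw [← Real.sin_add_pi]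
    ring_nf
  have c3 : Real.cos (3 * (Real.pi / 2) + Real.pi / 8) = Real.sin (Real.pi / 8) := by
    rw [← neg_neg (Real.sin _), ← c1, ← Real.cos_add_pi]
    ring_nf
  have s3 : Real.sin (3 * (Real.pi / 2) + Real.pi / 8) = -Real.cos (Real.pi / 8) := by
    rw [← s1, ← Real.sin_add_pi]
    ring_nf
  have key := sum_legendre_antiprism (x := x 0) (y := x 1) (z := x 2) hcs hcs' hw fun _ => rfl
  simp only [Finset.sum_apply, norm_Asq, norm_Bsq, hD, hx, one_div_sqrt_six_div_two]
  simp only [Vsq, Fin.sum_univ_four, Asq, Bsq, inner_pt,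
    Fin.coe_ofNat_eq_mod, Nat.reduceMod, Nat.cast_zero, Nat.cast_one, Nat.cast_ofNat, zero_mul,
    zero_add, one_mul, c1, s1, c2, s2, c3, s3, neg_neg]
  linear_combination (-(√6 / 3)) * key

theorem Vsq_sub_Vsq_zero_isBigO :
    (fun x : E3 => Vsq x - Vsq 0) =O[𝓝 0] fun x : E3 => ‖x‖ ^ 4 := by
  have hi (i : Fin 3) : (fun x : E3 => x i) =O[𝓝 0] fun x => ‖x‖ :=
    IsBigO.of_bound' (Filter.Eventually.of_forall fun x => by
      simpa using PiLp.norm_apply_le x i)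
  have h22 (i j : Fin 3) : (fun x : E3 => x i ^ 2 * x j ^ 2) =O[𝓝 0] fun x => ‖x‖ ^ 4 :=
    (((hi i).pow 2).mul ((hi j).pow 2)).congr_right fun x => by ring
  have h54 : (fun x : E3 => ‖x‖ ^ 5) =O[𝓝 0] fun x => ‖x‖ ^ 4 :=
    (isLittleO_norm_pow_norm_pow (by norm_num)).isBigO
  have hpoly := (((((h22 0 0).add (h22 1 1)).const_mul_left (-(7 / 108))).add
    ((h22 2 2).const_mul_left (-(14 / 81)))).add ((h22 0 1).const_mul_left (-(7 / 54)))).add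
    (((h22 2 0).add (h22 2 1)).const_mul_left (14 / 27))
  refine ((Vsq_sub_taylor_isBigO.trans h54).add (hpoly.const_mul_left (8 * √6 / 3))).congr_left
    fun x => ?_
  rw [Vsq_zero]
  ring

theorem iteratedFDeriv_Vsq_eq_zero {k : ℕ} (hk : k ≠ 0) (hk' : k ≤ 3) :
    iteratedFDeriv ℝ k Vsq 0 = 0 := by
  have h := (analyticAt_Vsq.sub analyticAt_const).iteratedFDeriv_eq_zero_of_isBigO
    (n := 3) Vsq_sub_Vsq_zero_isBigO hk'
  rwa [iteratedFDeriv_sub_apply analyticAt_Vsq.contDiffAt contDiffAt_const,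
    iteratedFDeriv_const_of_ne hk, Pi.zero_apply, sub_zero] at h

/-- `V(0) = 8√6/3`, all partial derivatives of `V` at the origin of
orders 1, 2 and 3 vanish, and the fourth-order Taylor expansion of `V` at the origin
is the stated one, with error `o(‖x‖⁴)`. -/
theorem stmt19 :
    Vsq 0 = 8 * Real.sqrt 6 / 3 ∧
    iteratedFDeriv ℝ 1 Vsq 0 = 0 ∧
    iteratedFDeriv ℝ 2 Vsq 0 = 0 ∧
    iteratedFDeriv ℝ 3 Vsq 0 = 0 ∧
    (fun x : E3 => Vsq x -
        (8 * Real.sqrt 6 / 3) *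
          (1 - (7 / 108) * ((x 0) ^ 4 + (x 1) ^ 4) - (14 / 81) * (x 2) ^ 4 -
            (7 / 54) * (x 0) ^ 2 * (x 1) ^ 2 +
            (14 / 27) * (x 2) ^ 2 * ((x 0) ^ 2 + (x 1) ^ 2)))
      =o[𝓝 0] fun x : E3 => ‖x‖ ^ 4 := by
  exact ⟨Vsq_zero, iteratedFDeriv_Vsq_eq_zero one_ne_zero (by norm_num),
    iteratedFDeriv_Vsq_eq_zero two_ne_zero (by norm_num),
    iteratedFDeriv_Vsq_eq_zero three_ne_zero le_rfl,
    Vsq_sub_taylor_isBigO.trans_isLittleO (isLittleO_norm_pow_norm_pow (by norm_num))⟩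
end
end
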